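/- arXiv:2507.04691 — 8 statements merged into one kernel-verified Lean document; each statement's English description precedes it below -/
import Mathlib

section
/- Let Γ be a rigid simple graph with vertex set S, let s₁ ∈ S and let s ∈ S ∖ star(s₁). Then there exists t ∈ S ∖ star(s₁) such that s and t are adjacent in Γ. -/
/-- For a subset `U` of the vertex set of a simple graph, `linkOfSet U` is the set of
vertices that are adjacent to every element of `U` (so `linkOfSet ∅` is everything). -/
def SimpleGraph.linkOfSet {S : Type*} (Γ : SimpleGraph S) (U : Set S) : Set S :=
  {t | ∀ u ∈ U, Γ.Adj u t}

/-- A simple graph is rigid if `link (link s) = {s}` for every vertex `s`. -/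
def SimpleGraph.Rigid {S : Type*} (Γ : SimpleGraph S) : Prop :=
  ∀ s : S, Γ.linkOfSet (Γ.neighborSet s) = {s}

/-- The star of a vertex: `star s = {s} ∪ link s`. -/
def SimpleGraph.starSet {S : Type*} (Γ : SimpleGraph S) (s : S) : Set S :=
  insert s (Γ.neighborSet s)

/-- If `Γ` is rigid, `s₁ ∈ S` and `s ∈ S ∖ star s₁`, then there is a vertex
`t ∈ S ∖ star s₁` adjacent to `s`. -/
theorem rigid_exists_adj_outside_star {S : Type*} (Γ : SimpleGraph S) (hΓ : Γ.Rigid)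
    (s₁ s : S) (hs : s ∉ Γ.starSet s₁) :
    ∃ t : S, t ∉ Γ.starSet s₁ ∧ Γ.Adj s t := by
  by_contra h
  push Not at h
  have hmem : s₁ ∈ Γ.linkOfSet (Γ.neighborSet s) := by
    intro u hu
    have hsu : Γ.Adj s u := hu
    by_cases hst : u ∈ Γ.starSet s₁
    · rcases hst with rfl | h1
      · exact absurd (Or.inr hsu.symm) hs
      · exact SimpleGraph.Adj.symm h1
    · exact absurd hsu (h u hst)
  rw [hΓ s] at hmem
  exact hs (Or.inl (Eq.symm hmem))
end

section
/- Let Γ be a simple graph with vertex set S, let s₁ ∈ S and let k ≥ 1 be an integer, and let Γ' be the associated simple graph with vertex set S' = star(s₁) ⊔ ([k] × (S ∖ star(s₁))). Define π : S' → S by π(s) = s for s ∈ star(s₁) and π(i,s) = s for i ∈ [k] and s ∈ S ∖ star(s₁). Then: (a) whenever r and r' are adjacent in Γ', the vertices π(r) and π(r') are adjacent in Γ; (b) for every r ∈ S', the image π(link_{Γ'}(r)) equals link_Γ(π(r)). -/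
/-- The vertex set `S' = star(s₁) ⊔ ([k] × (S ∖ star(s₁)))` of the expanded graph. -/
def ExpandVertex {S : Type*} (Γ : SimpleGraph S) (s₁ : S) (k : ℕ) : Type _ :=
  {s : S // s ∈ Γ.starSet s₁} ⊕ (Fin k × {s : S // s ∉ Γ.starSet s₁})

/-- Given a simple graph `Γ` with vertex set `S`, a vertex `s₁` and `k ≥ 1`, the expanded
simple graph `Γ'` on the vertex set `star(s₁) ⊔ ([k] × (S ∖ star(s₁)))`:
two vertices of `star(s₁)` are adjacent iff they are adjacent in `Γ`; `(i,s)` and `(j,t)`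
are adjacent iff `i = j` and `s,t` are adjacent in `Γ`; and `s ∈ star(s₁)` and `(i,t)` are
adjacent iff `s` and `t` are adjacent in `Γ`. -/
def SimpleGraph.expand {S : Type*} (Γ : SimpleGraph S) (s₁ : S) (k : ℕ) :
    SimpleGraph (ExpandVertex Γ s₁ k) where
  Adj r r' :=
    match r, r' with
    | Sum.inl a, Sum.inl b => Γ.Adj a.1 b.1
    | Sum.inl a, Sum.inr ib => Γ.Adj a.1 ib.2.1
    | Sum.inr ib, Sum.inl a => Γ.Adj a.1 ib.2.1
    | Sum.inr ib, Sum.inr jc => ib.1 = jc.1 ∧ Γ.Adj ib.2.1 jc.2.1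
  symm := by
    refine ⟨?_⟩
    rintro (a | ⟨i, b⟩) (c | ⟨j, d⟩) h
    · exact h.symm
    · exact h
    · exact h
    · exact ⟨h.1.symm, h.2.symm⟩
  loopless := by
    refine ⟨?_⟩
    rintro (a | ⟨i, b⟩) h
    · exact Γ.loopless.irrefl _ h
    · exact Γ.loopless.irrefl _ h.2

/-- The canonical projection `π : S' → S`. -/
def expandProj {S : Type*} (Γ : SimpleGraph S) (s₁ : S) (k : ℕ) :
    ExpandVertex Γ s₁ k → S
  | Sum.inl a => a.1
  | Sum.inr ib => ib.2.1

/-- For the expanded graph `Γ'` of `Γ` (with `k ≥ 1`) and the projection `π : S' → S`: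
(a) adjacency in `Γ'` is sent to adjacency in `Γ`;
(b) `π (link_{Γ'} r) = link_Γ (π r)` for every vertex `r` of `Γ'`. -/
theorem expand_proj_adj_and_link {S : Type*} (Γ : SimpleGraph S) (s₁ : S) (k : ℕ)
    (hk : 1 ≤ k) :
    (∀ r r' : ExpandVertex Γ s₁ k, (Γ.expand s₁ k).Adj r r' →
        Γ.Adj (expandProj Γ s₁ k r) (expandProj Γ s₁ k r')) ∧
    (∀ r : ExpandVertex Γ s₁ k,
        expandProj Γ s₁ k '' ((Γ.expand s₁ k).neighborSet r)
          = Γ.neighborSet (expandProj Γ s₁ k r)) := by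
  have ha : ∀ r r' : ExpandVertex Γ s₁ k, (Γ.expand s₁ k).Adj r r' →
      Γ.Adj (expandProj Γ s₁ k r) (expandProj Γ s₁ k r') := by
    rintro (a | ⟨i, b⟩) (c | ⟨j, d⟩) h
    · exact h
    · exact h
    · exact SimpleGraph.Adj.symm h
    · exact h.2
  refine ⟨ha, fun r => Set.Subset.antisymm ?_ ?_⟩
  · rintro _ ⟨r', hr', rfl⟩
    exact ha r r' hr'
  · intro t ht
    by_cases hs : t ∈ Γ.starSet s₁
    · refine ⟨Sum.inl ⟨t, hs⟩, ?_, rfl⟩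
      rcases r with a | ⟨i, b⟩
      · exact ht
      · exact SimpleGraph.Adj.symm ht
    · rcases r with a | ⟨i, b⟩
      · exact ⟨Sum.inr (⟨0, hk⟩, ⟨t, hs⟩), ht, rfl⟩
      · exact ⟨Sum.inr (i, ⟨t, hs⟩), ⟨rfl, ht⟩, rfl⟩
end

section
/- Let Γ be a simple graph with vertex set S, let s₁ ∈ S and let k ≥ 1 be an integer, and let Γ' be the associated simple graph with vertex set S' = star(s₁) ⊔ ([k] × (S ∖ star(s₁))). If Γ is rigid, then Γ' is rigid. -/
/-- If `Γ` is rigid (and `k ≥ 1`), then the expanded graph `Γ'` is rigid. -/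
theorem expand_rigid {S : Type*} (Γ : SimpleGraph S) (s₁ : S) (k : ℕ) (hk : 1 ≤ k)
    (hΓ : Γ.Rigid) : (Γ.expand s₁ k).Rigid := by
  have key : ∀ a b : S, (∀ u, Γ.Adj a u → Γ.Adj u b) → b = a := by
    intro a b h
    have hb : b ∈ Γ.linkOfSet (Γ.neighborSet a) := fun u hu => h u hu
    rw [hΓ a] at hb
    exact hb
  intro v
  apply Set.eq_singleton_iff_unique_mem.2
  refine ⟨fun u hu => SimpleGraph.Adj.symm hu, ?_⟩
  intro w hw
  have hw' : ∀ u, (Γ.expand s₁ k).Adj v u → (Γ.expand s₁ k).Adj u w := fun u hu => hw u hu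
  clear hw
  rcases v with a | ⟨i, a⟩ <;> rcases w with b | ⟨j, b⟩
  · have := key a.1 b.1 (fun u hu => by
      by_cases hs : u ∈ Γ.starSet s₁
      · exact hw' (Sum.inl ⟨u, hs⟩) hu
      · exact SimpleGraph.Adj.symm (hw' (Sum.inr (⟨0, hk⟩, ⟨u, hs⟩)) hu))
    exact congrArg Sum.inl (Subtype.ext this)
  · have := key a.1 b.1 (fun u hu => by
      by_cases hs : u ∈ Γ.starSet s₁
      · exact hw' (Sum.inl ⟨u, hs⟩) hu
      · exact (hw' (Sum.inr (j, ⟨u, hs⟩)) hu).2)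
    exact absurd (this ▸ a.2) b.2
  · have := key a.1 b.1 (fun u hu => by
      by_cases hs : u ∈ Γ.starSet s₁
      · exact hw' (Sum.inl ⟨u, hs⟩) (Γ.symm.symm _ _ hu : Γ.Adj u a.1)
      · exact SimpleGraph.Adj.symm (hw' (Sum.inr (i, ⟨u, hs⟩)) ⟨rfl, hu⟩))
    exact absurd (this ▸ b.2) a.2
  · by_cases hij : i = j
    · subst hij
      have := key a.1 b.1 (fun u hu => by
        by_cases hs : u ∈ Γ.starSet s₁
        · exact hw' (Sum.inl ⟨u, hs⟩) (Γ.symm.symm _ _ hu : Γ.Adj u a.1)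
        · exact (hw' (Sum.inr (i, ⟨u, hs⟩)) ⟨rfl, hu⟩).2)
      have hba : b = a := Subtype.ext this
      rw [hba]
    · exfalso
      have := key a.1 s₁ (fun u hu => by
        by_cases hs : u ∈ Γ.starSet s₁
        · rcases hs with hs | hs
          · subst hs
            exact absurd (Or.inr hu.symm) a.2
          · exact SimpleGraph.Adj.symm hs
        · exact absurd (hw' (Sum.inr (i, ⟨u, hs⟩)) ⟨rfl, hu⟩).1 hij)
      exact a.2 (Or.inl this.symm)
end

section
/- Let H₁, L, K be groups, let ι : L → K be an injective homomorphism, and let G = (H₁ × L) ∗_L K be the amalgamated free product of H₁ × L and K over L, where L embeds into H₁ × L as l ↦ (1,l) and into K via ι; identify H₁ × L and K with their canonical images in G. Let H ≤ H₁ be a subgroup of index k and let g₁,…,g_k ∈ H₁ be such that g₁H,…,g_kH are the k distinct cosets of H in H₁ (writing gᵢ also for the image of (gᵢ,1) in G). Then each conjugation map K → G, x ↦ gᵢ⁻¹ x gᵢ, restricts to the identity on L, and the induced homomorphism from the amalgamated free product of k copies of K over L (with respect to ι in each copy) to G, sending the i-th copy of K via x ↦ gᵢ⁻¹ x gᵢ,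 is injective. -/
/-- A two-element family of groups, used to form the amalgamated free product `A ∗_L K`
as an indexed pushout over `Bool`. -/
def AmalgFam (A K : Type u) : Bool → Type u := fun b => cond b A K

instance {A K : Type u} [Group A] [Group K] : ∀ b, Group (AmalgFam A K b)
  | true => inferInstanceAs (Group A)
  | false => inferInstanceAs (Group K)

/-- The pair of embeddings of the amalgamating group `L` into `A` and `K`. -/
def amalgMaps {L : Type*} {A K : Type u} [Group L] [Group A] [Group K] (f : L →* A) (g : L →* K) :
    ∀ b, L →* AmalgFam A K b
  | true => f
  | false => g

/-- The amalgamated free product `A ∗_L K` of two groups over `L`, with respect to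
homomorphisms `f : L →* A` and `g : L →* K`, as a pushout in the category of groups. -/
def Amalg {L : Type*} {A K : Type u} [Group L] [Group A] [Group K] (f : L →* A) (g : L →* K) : Type _ :=
  Monoid.PushoutI (amalgMaps f g)

instance {L : Type*} {A K : Type u} [Group L] [Group A] [Group K] (f : L →* A) (g : L →* K) :
    Group (Amalg f g) :=
  inferInstanceAs (Group (Monoid.PushoutI (amalgMaps f g)))

/-- The canonical map `A →* A ∗_L K`. -/
def Amalg.inlHom {L : Type*} {A K : Type u} [Group L] [Group A] [Group K] (f : L →* A) (g : L →* K) :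
    A →* Amalg f g :=
  Monoid.PushoutI.of (φ := amalgMaps f g) true

/-- The canonical map `K →* A ∗_L K`. -/
def Amalg.inrHom {L : Type*} {A K : Type u} [Group L] [Group A] [Group K] (f : L →* A) (g : L →* K) :
    K →* Amalg f g :=
  Monoid.PushoutI.of (φ := amalgMaps f g) false

open Monoid in
/-- The permutation of copies. -/
def reidx {L K : Type*} [Group L] [Group K] (ι : L →* K) {I J : Type*} (s : I → J) :
    PushoutI (fun _ : I => ι) →* PushoutI (fun _ : J => ι) :=
  PushoutI.lift (fun i => PushoutI.of (φ := fun _ : J => ι) (s i))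
    (PushoutI.base (fun _ : J => ι))
    (fun i => PushoutI.of_comp_eq_base (φ := fun _ : J => ι) (s i))

open Monoid in
theorem reidx_of {L K : Type*} [Group L] [Group K] (ι : L →* K) {I J : Type*} (s : I → J)
    (i : I) (x : K) :
    reidx ι s (PushoutI.of (φ := fun _ : I => ι) i x) =
      PushoutI.of (φ := fun _ : J => ι) (s i) x :=
  PushoutI.lift_of _ _ _ _

open Monoid in
theorem reidx_base {L K : Type*} [Group L] [Group K] (ι : L →* K) {I J : Type*} (s : I → J)
    (x : L) :
    reidx ι s (PushoutI.base (fun _ : I => ι) x) = PushoutI.base (fun _ : J => ι) x :=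
  PushoutI.lift_base _ _ _ _

theorem reidx_comp {L K : Type*} [Group L] [Group K] (ι : L →* K) {I J M : Type*} (s : I → J)
    (t : J → M) (x : Monoid.PushoutI (fun _ : I => ι)) :
    reidx ι t (reidx ι s x) = reidx ι (t ∘ s) x := by
  induction x using Monoid.PushoutI.induction_on with
  | of i g => simp only [reidx_of, Function.comp]
  | base h => simp only [reidx_base]
  | mul x y hx hy => simp only [map_mul, hx, hy]

theorem reidx_id {L K : Type*} [Group L] [Group K] (ι : L →* K) {I : Type*} (s : I → I)
    (hs : ∀ i, s i = i) (x : Monoid.PushoutI (fun _ : I => ι)) :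
    reidx ι s x = x := by
  induction x using Monoid.PushoutI.induction_on with
  | of i g => simp only [reidx_of, hs]
  | base h => simp only [reidx_base]
  | mul x y hx hy => simp only [map_mul, hx, hy]

/-- The action of `H₁` permuting the copies. -/
def shiftAct {L K : Type*} [Group L] [Group K] (ι : L →* K) (H₁ : Type*) [Group H₁] :
    H₁ →* MulAut (Monoid.PushoutI (fun _ : H₁ => ι)) where
  toFun h := MonoidHom.toMulEquiv (reidx ι (fun j => h * j)) (reidx ι (fun j => h⁻¹ * j))
    (by
      refine MonoidHom.ext fun x => ?_
      rw [MonoidHom.comp_apply, reidx_comp]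
      exact reidx_id _ _ (by simp) x)
    (by
      refine MonoidHom.ext fun x => ?_
      rw [MonoidHom.comp_apply, reidx_comp]
      exact reidx_id _ _ (by simp) x)
  map_one' := by
    refine MulEquiv.ext fun x => ?_
    exact reidx_id _ _ (by simp) x
  map_mul' a b := by
    refine MulEquiv.ext fun x => ?_
    refine Eq.trans ?_ (reidx_comp ι (fun j => b * j) (fun j => a * j) x).symm
    change reidx ι _ x = _
    congr 2
    funext j
    simp [mul_assoc]

theorem shiftAct_apply {L K : Type*} [Group L] [Group K] (ι : L →* K) (H₁ : Type*) [Group H₁]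
    (h : H₁) (x : Monoid.PushoutI (fun _ : H₁ => ι)) :
    shiftAct ι H₁ h x = reidx ι (fun j => h * j) x := rfl

theorem amalg_lift_exists {L : Type*} {A K : Type u} {M : Type*} [Group L] [Group A] [Group K]
    [Group M] (f : L →* A) (g : L →* K) (a : A →* M) (b : K →* M)
    (hab : ∀ l, a (f l) = b (g l)) :
    ∃ F : Amalg f g →* M, (∀ x, F (Amalg.inlHom f g x) = a x) ∧
      (∀ x, F (Amalg.inrHom f g x) = b x) := by
  let fam : ∀ i, AmalgFam A K i →* M := fun i => match i with
    | true => a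
    | false => b
  let F : Monoid.PushoutI (amalgMaps f g) →* M := Monoid.PushoutI.lift fam (b.comp g) (by
    rintro (_ | _)
    · rfl
    · exact MonoidHom.ext hab)
  exact ⟨F, fun x => Monoid.PushoutI.lift_of (φ := amalgMaps f g) fam _ _ (i := true) x,
    fun x => Monoid.PushoutI.lift_of (φ := amalgMaps f g) fam _ _ (i := false) x⟩

theorem amalg_glue {L : Type*} {A K : Type u} [Group L] [Group A] [Group K]
    (f : L →* A) (g : L →* K) (l : L) :
    Amalg.inlHom f g (f l) = Amalg.inrHom f g (g l) :=
  (Monoid.PushoutI.of_apply_eq_base (amalgMaps f g) true l).trans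
    (Monoid.PushoutI.of_apply_eq_base (amalgMaps f g) false l).symm

/-- Let `G = (H₁ × L) ∗_L K` be the amalgamated free product where `L` embeds into
`H₁ × L` as `l ↦ (1, l)` and into `K` via an injective homomorphism `ι`.  Let `H ≤ H₁` have
index `k`, with coset representatives `g 0, …, g (k-1)` of the `k` distinct cosets of `H`.
Then conjugation `x ↦ (g i)⁻¹ x (g i)` fixes the copy of `L` in `G` pointwise for each `i`, and
the induced homomorphism from the amalgamated free product of `k` copies of `K` over `L`
(each with respect to `ι`) to `G`, sending the `i`-th copy of `K` by `x ↦ (g i)⁻¹ x (g i)`,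
is injective. -/
theorem conj_copies_amalgam_injective {H₁ L K : Type u} [Group H₁] [Group L] [Group K]
    (ι : L →* K) (hι : Function.Injective ι)
    (H : Subgroup H₁) (k : ℕ) (hidx : H.index = k) (g : Fin k → H₁)
    (hg : Function.Bijective fun i : Fin k => (QuotientGroup.mk (g i) : H₁ ⧸ H)) :
    (∀ (i : Fin k) (l : L),
      (Amalg.inlHom (MonoidHom.inr H₁ L) ι ((g i, 1) : H₁ × L))⁻¹ *
          Amalg.inrHom (MonoidHom.inr H₁ L) ι (ι l) *
          Amalg.inlHom (MonoidHom.inr H₁ L) ι ((g i, 1) : H₁ × L) =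
        Amalg.inrHom (MonoidHom.inr H₁ L) ι (ι l)) ∧
    ∃ ψ : Monoid.PushoutI (fun _ : Fin k => ι) →* Amalg (MonoidHom.inr H₁ L) ι,
      (∀ (i : Fin k) (x : K),
        ψ (Monoid.PushoutI.of (φ := fun _ : Fin k => ι) i x) =
          (Amalg.inlHom (MonoidHom.inr H₁ L) ι ((g i, 1) : H₁ × L))⁻¹ *
            Amalg.inrHom (MonoidHom.inr H₁ L) ι x *
            Amalg.inlHom (MonoidHom.inr H₁ L) ι ((g i, 1) : H₁ × L)) ∧
      Function.Injective ψ := by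
  have h1 : ∀ (i : Fin k) (l : L),
      (Amalg.inlHom (MonoidHom.inr H₁ L) ι ((g i, 1) : H₁ × L))⁻¹ *
          Amalg.inrHom (MonoidHom.inr H₁ L) ι (ι l) *
          Amalg.inlHom (MonoidHom.inr H₁ L) ι ((g i, 1) : H₁ × L) =
        Amalg.inrHom (MonoidHom.inr H₁ L) ι (ι l) := by
    intro i l
    rw [← amalg_glue, ← map_inv, ← map_mul, ← map_mul]
    simp
  refine ⟨h1, ?_⟩
  let c : Fin k → K →* Amalg (MonoidHom.inr H₁ L) ι := fun i =>
    (MulAut.conj (Amalg.inlHom (MonoidHom.inr H₁ L) ι ((g i, 1) : H₁ × L))⁻¹).toMonoidHom.comp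
      (Amalg.inrHom (MonoidHom.inr H₁ L) ι)
  have hc : ∀ i x, c i x = (Amalg.inlHom (MonoidHom.inr H₁ L) ι ((g i, 1) : H₁ × L))⁻¹ *
            Amalg.inrHom (MonoidHom.inr H₁ L) ι x *
            Amalg.inlHom (MonoidHom.inr H₁ L) ι ((g i, 1) : H₁ × L) := by
    intro i x
    simp [c]
  let ψ : Monoid.PushoutI (fun _ : Fin k => ι) →* Amalg (MonoidHom.inr H₁ L) ι :=
    Monoid.PushoutI.lift c ((Amalg.inrHom (MonoidHom.inr H₁ L) ι).comp ι) (by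
      intro i
      refine MonoidHom.ext fun l => ?_
      rw [MonoidHom.comp_apply, hc, h1]
      rfl)
  have hψ : ∀ i x, ψ (Monoid.PushoutI.of (φ := fun _ : Fin k => ι) i x) = c i x :=
    fun i x => Monoid.PushoutI.lift_of _ _ _ _
  have hψb : ∀ l, ψ (Monoid.PushoutI.base (fun _ : Fin k => ι) l) =
      Amalg.inrHom (MonoidHom.inr H₁ L) ι (ι l) :=
    fun l => Monoid.PushoutI.lift_base _ _ _ _
  refine ⟨ψ, fun i x => (hψ i x).trans (hc i x), ?_⟩
  -- the target semidirect product
  have hcomm : ∀ (h : H₁) (l : L),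
      Commute (SemidirectProduct.inr h : _ ⋊[shiftAct ι H₁] H₁)
        (SemidirectProduct.inl (Monoid.PushoutI.base (fun _ : H₁ => ι) l)) := by
    intro h l
    have := SemidirectProduct.inl_aut (φ := shiftAct ι H₁) h
      (Monoid.PushoutI.base (fun _ : H₁ => ι) l)
    rw [shiftAct_apply, reidx_base, map_inv] at this
    exact (eq_mul_inv_iff_mul_eq.mp this).symm
  let a : H₁ × L →* _ ⋊[shiftAct ι H₁] H₁ :=
    MonoidHom.noncommCoprod SemidirectProduct.inr
      (SemidirectProduct.inl.comp (Monoid.PushoutI.base (fun _ : H₁ => ι))) hcomm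
  obtain ⟨F, hFl, hFr⟩ := amalg_lift_exists (MonoidHom.inr H₁ L) ι a
    (SemidirectProduct.inl.comp (Monoid.PushoutI.of (φ := fun _ : H₁ => ι) 1)) (by
      intro l
      have := Monoid.PushoutI.of_apply_eq_base (fun _ : H₁ => ι) 1 l
      simp [a, this])
  have hF : ∀ x, F (ψ x) = SemidirectProduct.inl (reidx ι (fun i => (g i)⁻¹) x) := by
    intro x
    induction x using Monoid.PushoutI.induction_on with
    | of i x =>
      rw [hψ, hc, map_mul, map_mul, map_inv, hFl, hFr, reidx_of]
      have := SemidirectProduct.inl_aut (φ := shiftAct ι H₁) (g i)⁻¹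
        (Monoid.PushoutI.of (φ := fun _ : H₁ => ι) 1 x)
      rw [shiftAct_apply, reidx_of, mul_one, inv_inv] at this
      rw [this]
      simp [a]
    | base l =>
      have := Monoid.PushoutI.of_apply_eq_base (fun _ : H₁ => ι) 1 l
      rw [hψb, hFr, reidx_base, MonoidHom.comp_apply, this]
    | mul x y hx hy => simp only [map_mul, hx, hy]
  have hginj : Function.Injective (fun i => (g i)⁻¹) := by
    intro i j hij
    apply hg.1
    have : g i = g j := inv_injective hij
    simp only [this]
  obtain ⟨i0, -⟩ := hg.2 (QuotientGroup.mk 1)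
  have : Nonempty (Fin k) := ⟨i0⟩
  intro x y hxy
  have h2 := congrArg F hxy
  rw [hF, hF] at h2
  have h3 := congrArg (reidx ι (Function.invFun (fun i => (g i)⁻¹)))
    (SemidirectProduct.inl_injective h2)
  rw [reidx_comp, reidx_comp] at h3
  have h4 := Function.leftInverse_invFun hginj
  exact (reidx_id ι _ h4 x).symm.trans (h3.trans (reidx_id ι _ h4 y))
end

section
/- Let H₁, L, K be groups, let ι : L → K be an injective homomorphism, and let G = (H₁ × L) ∗_L K be the amalgamated free product of H₁ × L and K over L, where L embeds into H₁ × L as l ↦ (1,l) and into K via ι; identify H₁ × L and K with their canonical images in G. Let H ≤ H₁ be a subgroup of index k and let g₁,…,g_k ∈ H₁ be such that g₁H,…,g_kH are the k distinct cosets of H in H₁ (writing gᵢ also for the image of (gᵢ,1) in G). Let 𝒢 ≤ G be the subgroup generated by H × L and the conjugates gᵢ⁻¹Kgᵢ, i = 1,…,k. Then the homomorphism from the amalgamated free product (H × L) ∗_L (∗_{L,i=1,…,k} K) — the pushout over L of the embedding L → H × L, l ↦ (1,l), and of k copies of ι : L → K — to G, sending H × L by the canonical inclusion and the i-th copy of K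 via x ↦ gᵢ⁻¹ x gᵢ, is injective with image 𝒢; moreover the cosets g₁𝒢,…,g_k𝒢 are pairwise distinct and their union is all of G, so that 𝒢 has index k in G. -/
open scoped Pointwise
/-- A family of groups over `Option (Fin k)`: the group `A` at `none` and a copy of the
group `K` at each `some i`; used to form the amalgamated free product
`A ∗_L (∗_{L, i = 1,…,k} K)` as an indexed pushout. -/
def BigFam (A K : Type u) (k : ℕ) : Option (Fin k) → Type u
  | none => A
  | some _ => K

instance {A K : Type u} {k : ℕ} [Group A] [Group K] : ∀ o, Group (BigFam A K k o)
  | none => inferInstanceAs (Group A)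
  | some _ => inferInstanceAs (Group K)

/-- The embeddings of the amalgamating group `L` into `A` and into the `k` copies of `K`. -/
def bigMaps {L : Type*} {A K : Type u} [Group L] [Group A] [Group K] (k : ℕ)
    (f : L →* A) (g : L →* K) : ∀ o : Option (Fin k), L →* BigFam A K k o
  | none => f
  | some _ => g

section helpers

theorem amalg_base {H₁ L K : Type u} [Group H₁] [Group L] [Group K] (ι : L →* K) (l : L) :
    Amalg.inlHom (MonoidHom.inr H₁ L) ι (1, l) = Amalg.inrHom (MonoidHom.inr H₁ L) ι (ι l) :=
  (Monoid.PushoutI.of_apply_eq_base (amalgMaps (MonoidHom.inr H₁ L) ι) true l).trans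
    (Monoid.PushoutI.of_apply_eq_base (amalgMaps (MonoidHom.inr H₁ L) ι) false l).symm

theorem amalg_lift {H₁ L K : Type u} [Group H₁] [Group L] [Group K] (ι : L →* K)
    {M : Type*} [Monoid M] (a : H₁ × L →* M) (b : K →* M) (hab : ∀ l, a (1, l) = b (ι l)) :
    ∃ Φ : Amalg (MonoidHom.inr H₁ L) ι →* M,
      (∀ x, Φ (Amalg.inlHom (MonoidHom.inr H₁ L) ι x) = a x) ∧
      (∀ x, Φ (Amalg.inrHom (MonoidHom.inr H₁ L) ι x) = b x) := by
  let f : ∀ i, AmalgFam (H₁ × L) K i →* M := fun i => match i with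
    | true => a
    | false => b
  refine ⟨Monoid.PushoutI.lift (φ := amalgMaps (MonoidHom.inr H₁ L) ι) f (b.comp ι) ?_, ?_, ?_⟩
  · rintro (_ | _)
    · rfl
    · ext l
      exact hab l
  · intro x
    exact Monoid.PushoutI.lift_of (φ := amalgMaps (MonoidHom.inr H₁ L) ι) f _ _ (i := true) x
  · intro x
    exact Monoid.PushoutI.lift_of (φ := amalgMaps (MonoidHom.inr H₁ L) ι) f _ _ (i := false) x

theorem amalg_induction {H₁ L K : Type u} [Group H₁] [Group L] [Group K] (ι : L →* K)
    (C : Amalg (MonoidHom.inr H₁ L) ι → Prop) (h1 : C 1)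
    (hl : ∀ a x, C x → C (Amalg.inlHom (MonoidHom.inr H₁ L) ι a * x))
    (hr : ∀ a x, C x → C (Amalg.inrHom (MonoidHom.inr H₁ L) ι a * x)) (x) : C x := by
  have key : ∀ y, C y → C (x * y) := by
    refine Monoid.PushoutI.induction_on (φ := amalgMaps (MonoidHom.inr H₁ L) ι)
      (motive := fun x => ∀ y : Amalg (MonoidHom.inr H₁ L) ι, C y →
        C (HMul.hMul (α := Amalg (MonoidHom.inr H₁ L) ι) x y)) x ?_ ?_ ?_
    · rintro (_ | _) a y hy
      · exact hr a y hy
      · exact hl a y hy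
    · intro l y hy
      rw [← Monoid.PushoutI.of_apply_eq_base (amalgMaps (MonoidHom.inr H₁ L) ι) true l]
      exact hl _ y hy
    · intro a b ha hb y hy
      have h3 := ha _ (hb y hy)
      have h4 : ∀ a b y : Amalg (MonoidHom.inr H₁ L) ι, C (a * (b * y)) → C (a * b * y) := by
        intro a b y h
        rwa [mul_assoc]
      exact h4 a b y h3
  simpa using key 1 h1

/-- inclusion of `H × L` -/
def bigN {L A K : Type u} [Group L] [Group A] [Group K] (k : ℕ) (f : L →* A) (ι : L →* K) :
    A →* Monoid.PushoutI (bigMaps k f ι) :=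
  Monoid.PushoutI.of (φ := bigMaps k f ι) none

/-- inclusion of the copies of `K` -/
def bigK {L A K : Type u} [Group L] [Group A] [Group K] (k : ℕ) (f : L →* A) (ι : L →* K)
    (i : Fin k) : K →* Monoid.PushoutI (bigMaps k f ι) :=
  Monoid.PushoutI.of (φ := bigMaps k f ι) (some i)

theorem big_base {L A K : Type u} [Group L] [Group A] [Group K] (k : ℕ) (f : L →* A) (ι : L →* K)
    (i : Fin k) (l : L) : bigN k f ι (f l) = bigK k f ι i (ι l) :=
  (Monoid.PushoutI.of_apply_eq_base (bigMaps k f ι) none l).trans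
    (Monoid.PushoutI.of_apply_eq_base (bigMaps k f ι) (some i) l).symm

theorem big_lift {L A K : Type u} [Group L] [Group A] [Group K] (k : ℕ) (f : L →* A) (ι : L →* K)
    {M : Type*} [Monoid M] (a : A →* M) (b : Fin k → K →* M)
    (hab : ∀ i l, b i (ι l) = a (f l)) :
    ∃ Φ : Monoid.PushoutI (bigMaps k f ι) →* M,
      (∀ x, Φ (bigN k f ι x) = a x) ∧ (∀ i x, Φ (bigK k f ι i x) = b i x) := by
  let F : ∀ i, BigFam A K k i →* M := fun i => match i with
    | none => a
    | some i => b i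
  refine ⟨Monoid.PushoutI.lift (φ := bigMaps k f ι) F (a.comp f) ?_, ?_, ?_⟩
  · rintro (_ | i)
    · rfl
    · ext l
      exact hab i l
  · intro x
    exact Monoid.PushoutI.lift_of (φ := bigMaps k f ι) F _ _ (i := none) x
  · intro i x
    exact Monoid.PushoutI.lift_of (φ := bigMaps k f ι) F _ _ (i := some i) x

theorem big_induction {L A K : Type u} [Group L] [Group A] [Group K] (k : ℕ) (f : L →* A)
    (ι : L →* K) (C : Monoid.PushoutI (bigMaps k f ι) → Prop)
    (hl : ∀ a, C (bigN k f ι a)) (hr : ∀ i a, C (bigK k f ι i a))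
    (hm : ∀ x y, C x → C y → C (x * y)) (x) : C x := by
  refine Monoid.PushoutI.induction_on x ?_ ?_ hm
  · rintro (_ | i) a
    · exact hl a
    · exact hr i a
  · intro l
    rw [← Monoid.PushoutI.of_apply_eq_base (bigMaps k f ι) none l]
    exact hl _

/-- The induced action of `G` on `Fin k × P`, in terms of a map `E : H₁ × P → Fin k × P`. -/
theorem exists_action {H₁ L K : Type u} [Group H₁] [Group L] [Group K]
    (ι : L →* K) (H : Subgroup H₁) (k : ℕ) (g : Fin k → H₁)
    (hg : Function.Bijective fun i : Fin k => (QuotientGroup.mk (g i) : H₁ ⧸ H))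
    {P : Type*} [Group P] (oN : ↥H × L →* P) (oK : Fin k → K →* P)
    (hc : ∀ i l, oN (1, l) = oK i (ι l)) :
    ∃ (E : H₁ → P → Fin k × P)
      (Φ : Amalg (MonoidHom.inr H₁ L) ι →* Function.End (Fin k × P)),
      (∀ i p, E (g i) p = (i, p)) ∧
      (∀ x (h : H) p, E (x * h) p = E x (oN (h, 1) * p)) ∧
      (∀ h l x p, Φ (Amalg.inlHom (MonoidHom.inr H₁ L) ι (h, l)) (E x p)
        = E (h * x) (oN (1, l) * p)) ∧
      (∀ y i p, Φ (Amalg.inrHom (MonoidHom.inr H₁ L) ι y) (i, p) = (i, oK i y * p)) := by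
  obtain ⟨idx, hidx1, hidx2⟩ := Function.bijective_iff_has_inverse.1 hg
  have hmem : ∀ x : H₁, (g (idx x))⁻¹ * x ∈ H := fun x => QuotientGroup.eq.1 (hidx2 x)
  let E : H₁ → P → Fin k × P := fun x p => (idx x, oN (⟨_, hmem x⟩, 1) * p)
  have hE1 : ∀ i p, E (g i) p = (i, p) := by
    intro i p
    have h1 : idx (g i) = i := hidx1 i
    have : (⟨_, hmem (g i)⟩ : H) = 1 := by
      ext; simp [h1]
    simp only [E, this]
    rw [h1, Prod.mk_one_one, map_one, one_mul]
  have hE2 : ∀ x (h : H) p, E (x * h) p = E x (oN (h, 1) * p) := by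
    intro x h p
    have h1 : (QuotientGroup.mk (x * h) : H₁ ⧸ H) = QuotientGroup.mk x :=
      QuotientGroup.mk_mul_of_mem x h.2
    have : (⟨_, hmem (x * h)⟩ : H) = ⟨_, hmem x⟩ * h := by
      ext; simp [h1, mul_assoc]
    simp only [E, this]
    rw [h1, ← mul_assoc, ← map_mul, Prod.mk_mul_mk, one_mul]
  have hEs : ∀ z : Fin k × P, z = E (g z.1) z.2 := fun z => (hE1 _ _).symm
  have hcomm : ∀ (h : H) l, oN (h, 1) * oN (1, l) = oN (1, l) * oN (h, 1) := by
    intro h l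
    rw [← map_mul, ← map_mul]; simp
  have hE3 : ∀ h l x p, E (h * g (E x p).1) (oN (1, l) * (E x p).2)
      = E (h * x) (oN (1, l) * p) := by
    intro h l x p
    have : h * x = h * g (idx x) * (⟨_, hmem x⟩ : H) := by simp [mul_assoc]
    rw [this, hE2, ← mul_assoc, ← hcomm, mul_assoc]
  let a : H₁ × L →* Function.End (Fin k × P) :=
    { toFun := fun x z => E (x.1 * g z.1) (oN (1, x.2) * z.2)
      map_one' := by
        funext z
        change E (1 * g z.1) (oN (1, 1) * z.2) = z
        rw [one_mul, Prod.mk_one_one, map_one, one_mul, hE1]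
      map_mul' := by
        intro x y
        funext z
        change E (x.1 * y.1 * g z.1) (oN (1, x.2 * y.2) * z.2) =
          E (x.1 * g (E (y.1 * g z.1) (oN (1, y.2) * z.2)).1)
            (oN (1, x.2) * (E (y.1 * g z.1) (oN (1, y.2) * z.2)).2)
        rw [hE3, ← mul_assoc, ← mul_assoc, ← map_mul, Prod.mk_mul_mk, one_mul] }
  let b : K →* Function.End (Fin k × P) :=
    { toFun := fun y z => (z.1, oK z.1 y * z.2)
      map_one' := by
        funext z
        change (z.1, oK z.1 1 * z.2) = z
        rw [map_one, one_mul]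
      map_mul' := by
        intro x y
        funext z
        change (z.1, oK z.1 (x * y) * z.2) = (z.1, oK z.1 x * (oK z.1 y * z.2))
        rw [map_mul, mul_assoc] }
  obtain ⟨Φ, h1, h2⟩ := amalg_lift ι a b (by
    intro l
    funext z
    change E (1 * g z.1) (oN (1, l) * z.2) = (z.1, oK z.1 (ι l) * z.2)
    rw [one_mul, hE1, hc z.1])
  refine ⟨E, Φ, hE1, hE2, ?_, ?_⟩
  · intro h l x p
    rw [h1]
    exact hE3 h l x p
  · intro y i p
    rw [h2]
    rfl

end helpers

/-- Let `G = (H₁ × L) ∗_L K` with `L ↪ H₁ × L`, `l ↦ (1,l)`, and `L ↪ K` via the injective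
`ι`.  Let `H ≤ H₁` have index `k` with coset representatives `g 0, …, g (k-1)`, and let
`𝒢 ≤ G` be the subgroup generated by `H × L` and the conjugates `(g i)⁻¹ K (g i)`.  Then the
homomorphism from `(H × L) ∗_L (∗_{L,i} K)` to `G`, sending `H × L` by the canonical
inclusion and the `i`-th copy of `K` by `x ↦ (g i)⁻¹ x (g i)`, is injective with image `𝒢`;
moreover the cosets `(g i) 𝒢` are pairwise distinct with union all of `G`, and `𝒢` has
index `k` in `G`. -/
theorem amalgam_finite_index_subgroup {H₁ L K : Type u} [Group H₁] [Group L] [Group K]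
    (ι : L →* K) (hι : Function.Injective ι)
    (H : Subgroup H₁) (k : ℕ) (hidx : H.index = k) (g : Fin k → H₁)
    (hg : Function.Bijective fun i : Fin k => (QuotientGroup.mk (g i) : H₁ ⧸ H))
    (𝒢 : Subgroup (Amalg (MonoidHom.inr H₁ L) ι))
    (h𝒢 : 𝒢 = Subgroup.closure
      ({x | ∃ (h : H₁) (l : L), h ∈ H ∧ x = Amalg.inlHom (MonoidHom.inr H₁ L) ι (h, l)} ∪
       {x | ∃ (i : Fin k) (y : K),
          x = (Amalg.inlHom (MonoidHom.inr H₁ L) ι ((g i, 1) : H₁ × L))⁻¹ *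
                Amalg.inrHom (MonoidHom.inr H₁ L) ι y *
                Amalg.inlHom (MonoidHom.inr H₁ L) ι ((g i, 1) : H₁ × L)})) :
    ∃ ψ : Monoid.PushoutI (bigMaps k (MonoidHom.inr (↥H) L) ι) →*
        Amalg (MonoidHom.inr H₁ L) ι,
      (∀ (h : ↥H) (l : L),
        ψ (Monoid.PushoutI.of (φ := bigMaps k (MonoidHom.inr (↥H) L) ι) none
            (((h, l) : ↥H × L) : BigFam (↥H × L) K k none)) =
          Amalg.inlHom (MonoidHom.inr H₁ L) ι ((h : H₁), l)) ∧
      (∀ (i : Fin k) (x : K),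
        ψ (Monoid.PushoutI.of (φ := bigMaps k (MonoidHom.inr (↥H) L) ι) (some i) x) =
          (Amalg.inlHom (MonoidHom.inr H₁ L) ι ((g i, 1) : H₁ × L))⁻¹ *
            Amalg.inrHom (MonoidHom.inr H₁ L) ι x *
            Amalg.inlHom (MonoidHom.inr H₁ L) ι ((g i, 1) : H₁ × L)) ∧
      Function.Injective ψ ∧
      MonoidHom.range ψ = 𝒢 ∧
      (∀ i j : Fin k,
        (Amalg.inlHom (MonoidHom.inr H₁ L) ι ((g i, 1) : H₁ × L)) • (𝒢 : Set (Amalg (MonoidHom.inr H₁ L) ι)) =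
          (Amalg.inlHom (MonoidHom.inr H₁ L) ι ((g j, 1) : H₁ × L)) • (𝒢 : Set (Amalg (MonoidHom.inr H₁ L) ι)) → i = j) ∧
      (⋃ i : Fin k,
        (Amalg.inlHom (MonoidHom.inr H₁ L) ι ((g i, 1) : H₁ × L)) • (𝒢 : Set (Amalg (MonoidHom.inr H₁ L) ι))) =
        Set.univ ∧
      𝒢.index = k := by
  set f := MonoidHom.inr (↥H) L with hf
  set jl := Amalg.inlHom (MonoidHom.inr H₁ L) ι with hjl
  set jr := Amalg.inrHom (MonoidHom.inr H₁ L) ι with hjr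
  have hjc : ∀ x l, jl (x, 1) * jl (1, l) = jl (1, l) * jl (x, 1) := by
    intro x l
    rw [← map_mul, ← map_mul]; simp
  obtain ⟨ψ, hψN, hψK⟩ := big_lift k f ι
    (jl.comp ((H.subtype).prodMap (MonoidHom.id L)))
    (fun i => (MulAut.conj (jl (g i, 1))⁻¹).toMonoidHom.comp jr) (by
      intro i l
      have h1 : jr (ι l) = jl (1, l) := (amalg_base ι l).symm
      change (jl (g i, 1))⁻¹ * jr (ι l) * ((jl (g i, 1))⁻¹)⁻¹ = jl (1, l)
      rw [h1, inv_inv, mul_assoc, ← hjc, inv_mul_cancel_left])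
  have hψN' : ∀ (h : H) (l : L), ψ (bigN k f ι (h, l)) = jl ((h : H₁), l) := fun h l => hψN _
  have hψK' : ∀ i x, ψ (bigK k f ι i x) = (jl (g i, 1))⁻¹ * jr x * jl (g i, 1) := by
    intro i x
    rw [hψK]
    change (jl (g i, 1))⁻¹ * jr x * ((jl (g i, 1))⁻¹)⁻¹ = _
    rw [inv_inv]
  obtain ⟨E, Φ, hE1, hE2, hΦl, hΦr⟩ := exists_action ι H k g hg (bigN k f ι) (bigK k f ι)
    (fun i l => big_base k f ι i l)
  have hΦl1 : ∀ h x p, Φ (jl (h, 1)) (E x p) = E (h * x) p := by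
    intro h x p
    rw [hΦl, Prod.mk_one_one, map_one, one_mul]
  have hΦm : ∀ a b z, Φ (a * b) z = Φ a (Φ b z) := by
    intro a b z
    rw [map_mul]; rfl
  have hact : ∀ p q, Φ (ψ p) (E 1 q) = E 1 (p * q) := by
    intro p
    induction p using big_induction with
    | hl a =>
      intro q
      obtain ⟨h, l⟩ := a
      have := hE2 1 h (bigN k f ι (1, l) * q)
      rw [one_mul] at this
      rw [hψN', hΦl, mul_one, this, ← mul_assoc, ← map_mul, Prod.mk_mul_mk, one_mul, mul_one]
    | hr i y =>
      intro q
      rw [hψK', hΦm, hΦm, hΦl1, mul_one, hE1, hΦr, ← hE1, ← map_inv]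
      change Φ (jl ((g i)⁻¹, 1⁻¹)) _ = _
      rw [inv_one, hΦl1, inv_mul_cancel]
    | hm x y hx hy =>
      intro q
      rw [map_mul, hΦm, hy, hx, mul_assoc]
  have hEinj : ∀ p q, E 1 p = E 1 q → p = q := by
    intro p q h
    obtain ⟨i, hi⟩ := hg.2 (QuotientGroup.mk 1)
    have hm : (g i)⁻¹ * 1 ∈ H := QuotientGroup.eq.1 hi
    have h2 := hE2 (g i) ⟨_, hm⟩
    simp only [mul_inv_cancel_left] at h2
    rw [h2, h2, hE1, hE1] at h
    simpa using h
  have hrange : MonoidHom.range ψ = 𝒢 := by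
    subst h𝒢
    apply le_antisymm
    · rintro _ ⟨p, rfl⟩
      induction p using big_induction with
      | hl a =>
        obtain ⟨h, l⟩ := a
        exact Subgroup.subset_closure (Or.inl ⟨h, l, h.2, hψN' h l⟩)
      | hr i y => exact Subgroup.subset_closure (Or.inr ⟨i, y, hψK' i y⟩)
      | hm x y hx hy => rw [map_mul]; exact mul_mem hx hy
    · rw [Subgroup.closure_le]
      rintro _ (⟨h, l, hh, rfl⟩ | ⟨i, y, rfl⟩)
      · exact ⟨_, hψN' ⟨h, hh⟩ l⟩
      · exact ⟨_, hψK' i y⟩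
  have hdist : ∀ i j, (jl (g i, 1))⁻¹ * jl (g j, 1) ∈ 𝒢 → i = j := by
    intro i j h
    rw [← hrange] at h
    obtain ⟨p, hp⟩ := h
    have h1 : jl (g i, 1) * ψ p = jl (g j, 1) := by rw [hp, mul_inv_cancel_left]
    have h2 := congrArg (fun x => Φ x (E 1 1)) h1
    simp only [hΦm, hact, hΦl1, mul_one, hE1] at h2
    exact congrArg Prod.fst h2
  have hcov : ∀ x, ∃ i, (jl (g i, 1))⁻¹ * x ∈ 𝒢 := by
    have hN : ∀ h ∈ H, ∀ l, jl (h, l) ∈ 𝒢 := fun h hh l => hrange ▸ ⟨_, hψN' ⟨h, hh⟩ l⟩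
    have hst : ∀ (x : H₁) (l : L), ∃ i, (jl (g i, 1))⁻¹ * jl (x, l) ∈ 𝒢 := by
      intro x l
      obtain ⟨i, hi⟩ := hg.2 (QuotientGroup.mk x)
      refine ⟨i, ?_⟩
      rw [← map_inv, ← map_mul]
      exact hN _ (QuotientGroup.eq.1 hi) _
    intro x
    induction x using amalg_induction with
    | h1 =>
      obtain ⟨i, hi⟩ := hst 1 1
      exact ⟨i, by rwa [Prod.mk_one_one, map_one] at hi⟩
    | hl a x ih =>
      obtain ⟨i, hi⟩ := ih
      obtain ⟨j, hj⟩ := hst (a.1 * g i) a.2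
      refine ⟨j, ?_⟩
      have : jl (a.1 * g i, a.2) = jl a * jl (g i, 1) := by rw [← map_mul]; simp [Prod.mul_def]
      rw [this] at hj
      have := mul_mem hj hi
      simpa [mul_assoc] using this
    | hr y x ih =>
      obtain ⟨i, hi⟩ := ih
      refine ⟨i, ?_⟩
      have hj : (jl (g i, 1))⁻¹ * jr y * jl (g i, 1) ∈ 𝒢 := hrange ▸ ⟨_, hψK' i y⟩
      have := mul_mem hj hi
      simpa [mul_assoc] using this
  refine ⟨ψ, hψN', hψK', ?_, hrange, ?_, ?_, ?_⟩
  · intro p q h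
    apply hEinj
    rw [← mul_one p, ← mul_one q, ← hact, ← hact, h]
  · intro i j h
    exact hdist i j ((leftCoset_eq_iff 𝒢).1 h)
  · rw [Set.eq_univ_iff_forall]
    intro x
    obtain ⟨i, hi⟩ := hcov x
    exact Set.mem_iUnion.2 ⟨i, (mem_leftCoset_iff _).2 hi⟩
  · have hb : Function.Bijective (fun i : Fin k =>
        (QuotientGroup.mk (jl (g i, 1)) : Amalg (MonoidHom.inr H₁ L) ι ⧸ 𝒢)) := by
      constructor
      · intro i j h
        exact hdist i j (QuotientGroup.eq.1 h)
      · intro z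
        obtain ⟨x, rfl⟩ := QuotientGroup.mk_surjective z
        obtain ⟨i, hi⟩ := hcov x
        exact ⟨i, QuotientGroup.eq.2 hi⟩
    rw [Subgroup.index, ← Nat.card_eq_of_bijective _ hb, Nat.card_fin]
end

section
/- Let Γ be a simple graph with vertex set S, let s₁ ∈ S, let (G_s)_{s∈S} be a family of groups and let G be their graph product over Γ; identify each G_s with its canonical image in G. Let H ≤ G_{s₁} be a subgroup of finite index k and let g₁,…,g_k ∈ G_{s₁} be such that g₁H,…,g_kH are the k distinct cosets of H in G_{s₁}. Let Γ' be the associated simple graph with vertex set S' = star(s₁) ⊔ ([k] × (S ∖ star(s₁))), and label its vertices by the groups G'_{s₁} = H, G'_s = G_s for s ∈ link(s₁), and G'_{(i,s)} = G_s for i ∈ [k] and s ∈ S ∖ star(s₁); let G' be the graph product of this family over Γ'. Then there is a unique group homomorphism φ : G' → G such that φ(g) = g for every g in the canonical copy of G'_s in G' with s ∈ star(s₁), and φ(g) = gᵢ⁻¹ g gᵢ for every g in the canonical copy of G'_{(i,s)} with i ∈ [k] and s ∈ S ∖ star(s₁). Moreover, φ is injective and its image has index k in G. -/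
/-- The commutation relators defining the graph product of a family of groups `(G s)`
over a simple graph `Γ`: the commutators `[g, h]` with `g ∈ G s`, `h ∈ G t` and `s, t`
adjacent in `Γ`, viewed inside the free product `Monoid.CoprodI G`. -/
def graphProductRels {S : Type*} (Γ : SimpleGraph S) (G : S → Type*) [∀ s, Group (G s)] :
    Set (Monoid.CoprodI G) :=
  {x | ∃ (s t : S) (g : G s) (h : G t), Γ.Adj s t ∧
    x = Monoid.CoprodI.of g * Monoid.CoprodI.of h *
      (Monoid.CoprodI.of g)⁻¹ * (Monoid.CoprodI.of h)⁻¹}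

/-- The graph product of a family of groups `(G s)_{s ∈ S}` over a simple graph `Γ`:
the quotient of the free product of the `G s` by the normal closure of the commutators
`[g, h]` with `g ∈ G s`, `h ∈ G t` and `s, t` adjacent in `Γ`. -/
def GraphProduct {S : Type*} (Γ : SimpleGraph S) (G : S → Type*) [∀ s, Group (G s)] :
    Type _ :=
  Monoid.CoprodI G ⧸ Subgroup.normalClosure (graphProductRels Γ G)

instance {S : Type*} (Γ : SimpleGraph S) (G : S → Type*) [∀ s, Group (G s)] :
    Group (GraphProduct Γ G) :=
  inferInstanceAs (Group (Monoid.CoprodI G ⧸ Subgroup.normalClosure (graphProductRels Γ G)))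

/-- The canonical homomorphism from each vertex group into the graph product. -/
def GraphProduct.of {S : Type*} (Γ : SimpleGraph S) (G : S → Type*) [∀ s, Group (G s)]
    (s : S) : G s →* GraphProduct Γ G :=
  (QuotientGroup.mk' (Subgroup.normalClosure (graphProductRels Γ G))).comp
    (Monoid.CoprodI.of (i := s))

/-- The auxiliary family of subgroups: `H` at the vertex `s₁` and everything at the other
vertices. -/
def Hsub {S : Type*} [DecidableEq S] (G : S → Type*) [∀ s, Group (G s)] (s₁ : S)
    (H : Subgroup (G s₁)) : (s : S) → Subgroup (G s) := fun s =>
  if h : s = s₁ then h.symm ▸ H else ⊤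

/-- The labeling of the vertices of the expanded graph: the subgroup `H ≤ G s₁` at the
vertex `s₁`, the group `G s` at each vertex `s ∈ link s₁`, and the group `G s` at each
vertex `(i, s)` with `s ∉ star s₁`. -/
def expandLabel {S : Type*} [DecidableEq S] (Γ : SimpleGraph S) (G : S → Type*)
    [∀ s, Group (G s)] (s₁ : S) (H : Subgroup (G s₁)) (k : ℕ) :
    ExpandVertex Γ s₁ k → Type _
  | Sum.inl a => ↥(Hsub G s₁ H a.1)
  | Sum.inr ib => G ib.2.1

instance {S : Type*} [DecidableEq S] (Γ : SimpleGraph S) (G : S → Type*)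
    [∀ s, Group (G s)] (s₁ : S) (H : Subgroup (G s₁)) (k : ℕ) :
    ∀ v, Group (expandLabel Γ G s₁ H k v)
  | Sum.inl a => inferInstanceAs (Group ↥(Hsub G s₁ H a.1))
  | Sum.inr ib => inferInstanceAs (Group (G ib.2.1))

section helpers

theorem GraphProduct.of_comm {S : Type*} (Γ : SimpleGraph S) (G : S → Type*) [∀ s, Group (G s)]
    {s t : S} (h : Γ.Adj s t) (x : G s) (y : G t) :
    GraphProduct.of Γ G s x * GraphProduct.of Γ G t y =
      GraphProduct.of Γ G t y * GraphProduct.of Γ G s x := by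
  have h1 : (QuotientGroup.mk' (Subgroup.normalClosure (graphProductRels Γ G)))
      (Monoid.CoprodI.of x * Monoid.CoprodI.of y *
      (Monoid.CoprodI.of x)⁻¹ * (Monoid.CoprodI.of y)⁻¹) = 1 :=
    (QuotientGroup.eq_one_iff _).2 (Subgroup.subset_normalClosure ⟨s, t, x, y, h, rfl⟩)
  simp only [map_mul, map_inv] at h1
  rw [mul_inv_eq_one, mul_inv_eq_iff_eq_mul] at h1
  exact h1

theorem GraphProduct.exists_lift {S : Type*} (Γ : SimpleGraph S) (G : S → Type*)
    [∀ s, Group (G s)] {K : Type*} [Group K] (f : ∀ s, G s →* K)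
    (hf : ∀ s t, Γ.Adj s t → ∀ (x : G s) (y : G t), f s x * f t y = f t y * f s x) :
    ∃ F : GraphProduct Γ G →* K, ∀ s x, F (GraphProduct.of Γ G s x) = f s x := by
  refine ⟨QuotientGroup.lift _ (Monoid.CoprodI.lift f) ?_, ?_⟩
  · have : Subgroup.normalClosure (graphProductRels Γ G) ≤ (Monoid.CoprodI.lift f).ker := by
      apply Subgroup.normalClosure_le_normal
      rintro _ ⟨s, t, x, y, h, rfl⟩
      simp only [SetLike.mem_coe, MonoidHom.mem_ker, map_mul, map_inv, Monoid.CoprodI.lift_of]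
      rw [mul_inv_eq_one, mul_inv_eq_iff_eq_mul]
      exact hf s t h x y
    intro x hx
    exact this hx
  · intro s x
    exact Monoid.CoprodI.lift_of f x

theorem GraphProduct.induction {S : Type*} (Γ : SimpleGraph S) (G : S → Type*)
    [∀ s, Group (G s)] (P : GraphProduct Γ G → Prop) (h1 : P 1)
    (hof : ∀ s x, P (GraphProduct.of Γ G s x)) (hm : ∀ x y, P x → P y → P (x * y)) (z) : P z := by
  obtain ⟨w, rfl⟩ := QuotientGroup.mk'_surjective _ z
  induction w using Monoid.CoprodI.induction_on with
  | one => exact h1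
  | of i m => exact hof i m
  | mul x y hx hy =>
    rw [map_mul]; exact hm _ _ hx hy

def sliceHom {I M K : Type*} [Group M] [Group K] (f : I → M →* K) : M →* Equiv.Perm (I × K) :=
  MonoidHom.toHomPerm
    { toFun := fun u p => (p.1, f p.1 u * p.2)
      map_one' := by funext p; simp; rfl
      map_mul' := by intro u v; funext p; simp [mul_assoc]; rfl }

theorem sliceHom_apply {I M K : Type*} [Group M] [Group K] (f : I → M →* K) (u : M) (i : I)
    (y : K) : sliceHom f u (i, y) = (i, f i u * y) := rfl

theorem exists_cosetHom {I M K : Type*} [Group M] [Group K] (H : Subgroup M) (g : I → M)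
    (hg : Function.Bijective fun i => (QuotientGroup.mk (g i) : M ⧸ H)) (f : H →* K) :
    ∃ A : M →* Equiv.Perm (I × K), ∀ (u : M) (i j : I) (h : H) (y : K), u * g i = g j * h →
      A u (i, y) = (j, f h * y) := by
  have hex : ∀ v : M, ∃ p : I × H, v = g p.1 * p.2 := by
    intro v
    obtain ⟨i, hi⟩ := hg.2 (QuotientGroup.mk v)
    exact ⟨(i, ⟨(g i)⁻¹ * v, QuotientGroup.eq.1 hi⟩), by simp⟩
  choose c hc using hex
  have huniq : ∀ (i : I) (h : H) (v : M), v = g i * h → c v = (i, h) := by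
    intro i h v hv
    have h2 := (hc v).symm.trans hv
    have h1 : (c v).1 = i := by
      apply hg.1
      have := congrArg (QuotientGroup.mk : M → M ⧸ H) h2
      simpa using this
    rw [h1] at h2
    exact Prod.ext h1 (Subtype.ext (mul_left_cancel h2))
  refine ⟨MonoidHom.toHomPerm
    { toFun := fun u p => ((c (u * g p.1)).1, f (c (u * g p.1)).2 * p.2)
      map_one' := ?_
      map_mul' := ?_ }, ?_⟩
  · funext p
    have := huniq p.1 1 (1 * g p.1) (by simp)
    rw [this]; simp; rfl
  · intro u v
    funext p
    have h1 := hc (v * g p.1)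
    have h2 := hc (u * g (c (v * g p.1)).1)
    have := huniq (c (u * g (c (v * g p.1)).1)).1
      ((c (u * g (c (v * g p.1)).1)).2 * (c (v * g p.1)).2) (u * v * g p.1) (by
        rw [Subgroup.coe_mul, ← mul_assoc, ← h2, mul_assoc u, mul_assoc u, ← h1])
    simp only [this]
    simp only [map_mul, mul_assoc]
    rfl
  · intro u i j h y e
    have := huniq j h _ e
    change ((c (u * g i)).1, f (c (u * g i)).2 * y) = _
    rw [this]

theorem Hsub_self {S : Type*} [DecidableEq S] (G : S → Type*) [∀ s, Group (G s)] (s₁ : S)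
    (H : Subgroup (G s₁)) : Hsub G s₁ H s₁ = H := by simp [Hsub]

theorem Hsub_ne {S : Type*} [DecidableEq S] (G : S → Type*) [∀ s, Group (G s)] (s₁ : S)
    (H : Subgroup (G s₁)) {s : S} (h : s ≠ s₁) : Hsub G s₁ H s = ⊤ := by simp [Hsub, h]

theorem notMem_star {S : Type*} {Γ : SimpleGraph S} {s₁ s : S} (h : s ∉ Γ.starSet s₁) :
    s ≠ s₁ ∧ ¬ Γ.Adj s₁ s := by
  simpa [SimpleGraph.starSet] using h

end helpers

/-- Let `G` be the graph product over `Γ` of groups `(G_s)`, let `H ≤ G_{s₁}` have index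
`k`, with coset representatives `g 0, …, g (k-1)`, and let `G'` be the graph product over
the expanded graph `Γ'` of the groups `G'_{s₁} = H`, `G'_s = G_s` for `s ∈ link s₁` and
`G'_{(i,s)} = G_s` for `s ∉ star s₁`.  Then there is a unique homomorphism `φ : G' → G`
that is the canonical embedding on each `G'_s`, `s ∈ star s₁`, and is `x ↦ (g i)⁻¹ x (g i)`
on the copy of `G'_{(i,s)}`; moreover `φ` is injective and its image has index `k`. -/
theorem graphProduct_expand_embedding {S : Type*} [DecidableEq S] (Γ : SimpleGraph S)
    (G : S → Type*) [∀ s, Group (G s)] (s₁ : S) (H : Subgroup (G s₁)) (k : ℕ)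
    (hidx : H.index = k) (g : Fin k → G s₁)
    (hg : Function.Bijective fun i : Fin k => (QuotientGroup.mk (g i) : G s₁ ⧸ H)) :
    ∃ φ : GraphProduct (Γ.expand s₁ k) (expandLabel Γ G s₁ H k) →* GraphProduct Γ G,
      (∀ (a : {s : S // s ∈ Γ.starSet s₁}) (x : ↥(Hsub G s₁ H a.1)),
        φ (GraphProduct.of (Γ.expand s₁ k) (expandLabel Γ G s₁ H k) (Sum.inl a) x) =
          GraphProduct.of Γ G a.1 (x : G a.1)) ∧
      (∀ (i : Fin k) (b : {s : S // s ∉ Γ.starSet s₁}) (x : G b.1),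
        φ (GraphProduct.of (Γ.expand s₁ k) (expandLabel Γ G s₁ H k) (Sum.inr (i, b)) x) =
          (GraphProduct.of Γ G s₁ (g i))⁻¹ * GraphProduct.of Γ G b.1 x *
            GraphProduct.of Γ G s₁ (g i)) ∧
      (∀ ψ : GraphProduct (Γ.expand s₁ k) (expandLabel Γ G s₁ H k) →* GraphProduct Γ G,
        ((∀ (a : {s : S // s ∈ Γ.starSet s₁}) (x : ↥(Hsub G s₁ H a.1)),
          ψ (GraphProduct.of (Γ.expand s₁ k) (expandLabel Γ G s₁ H k) (Sum.inl a) x) =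
            GraphProduct.of Γ G a.1 (x : G a.1)) ∧
         (∀ (i : Fin k) (b : {s : S // s ∉ Γ.starSet s₁}) (x : G b.1),
          ψ (GraphProduct.of (Γ.expand s₁ k) (expandLabel Γ G s₁ H k) (Sum.inr (i, b)) x) =
            (GraphProduct.of Γ G s₁ (g i))⁻¹ * GraphProduct.of Γ G b.1 x *
              GraphProduct.of Γ G s₁ (g i))) → ψ = φ) ∧
      Function.Injective φ ∧
      (MonoidHom.range φ).index = k := by
  have hs₁ : s₁ ∈ Γ.starSet s₁ := Set.mem_insert _ _
  have hlk : ∀ s, Γ.Adj s₁ s → s ∈ Γ.starSet s₁ := fun s h => Set.mem_insert_of_mem _ h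
  have hstar : ∀ s, s ∈ Γ.starSet s₁ → s = s₁ ∨ Γ.Adj s₁ s := fun s h => h
  let O := GraphProduct.of Γ G
  let K := GraphProduct (Γ.expand s₁ k) (expandLabel Γ G s₁ H k)
  let Ol : ∀ a : {s : S // s ∈ Γ.starSet s₁}, ↥(Hsub G s₁ H a.1) →* K := fun a =>
    GraphProduct.of (Γ.expand s₁ k) (expandLabel Γ G s₁ H k) (Sum.inl a)
  let Or : ∀ (i : Fin k) (b : {s : S // s ∉ Γ.starSet s₁}), G b.1 →* K := fun i b =>
    GraphProduct.of (Γ.expand s₁ k) (expandLabel Γ G s₁ H k) (Sum.inr (i, b))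
  have hll : ∀ a b, Γ.Adj a.1 b.1 → ∀ x y, Ol a x * Ol b y = Ol b y * Ol a x :=
    fun a b h x y => GraphProduct.of_comm (Γ.expand s₁ k) (expandLabel Γ G s₁ H k)
      (s := Sum.inl a) (t := Sum.inl b) h x y
  have hlr : ∀ a i b, Γ.Adj a.1 b.1 → ∀ x y, Ol a x * Or i b y = Or i b y * Ol a x :=
    fun a i b h x y => GraphProduct.of_comm (Γ.expand s₁ k) (expandLabel Γ G s₁ H k)
      (s := Sum.inl a) (t := Sum.inr (i, b)) h x y
  have hrr : ∀ i a b, Γ.Adj a.1 b.1 → ∀ x y, Or i a x * Or i b y = Or i b y * Or i a x :=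
    fun i a b h x y => GraphProduct.of_comm (Γ.expand s₁ k) (expandLabel Γ G s₁ H k)
      (s := Sum.inr (i, a)) (t := Sum.inr (i, b)) ⟨rfl, h⟩ x y
  have hind : ∀ P : K → Prop, P 1 → (∀ a x, P (Ol a x)) → (∀ i b x, P (Or i b x)) →
      (∀ x y, P x → P y → P (x * y)) → ∀ z, P z := by
    intro P h1 hl hr hm z
    refine GraphProduct.induction _ _ P h1 ?_ hm z
    rintro (a | ⟨i, b⟩) x
    · exact hl a x
    · exact hr i b x
  have hO : ∀ {s t}, Γ.Adj s t → ∀ x y, O s x * O t y = O t y * O s x :=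
    fun h x y => GraphProduct.of_comm Γ G h x y
  -- the homomorphism
  obtain ⟨φ, hφl, hφr⟩ : ∃ φ : K →* GraphProduct Γ G, (∀ a x, φ (Ol a x) = O a.1 (x : G a.1)) ∧
      (∀ i b x, φ (Or i b x) = (O s₁ (g i))⁻¹ * O b.1 x * O s₁ (g i)) := by
    let fl : ∀ a : {s : S // s ∈ Γ.starSet s₁}, ↥(Hsub G s₁ H a.1) →* GraphProduct Γ G :=
      fun a => (O a.1).comp (Hsub G s₁ H a.1).subtype
    let fr : ∀ ib : Fin k × {s : S // s ∉ Γ.starSet s₁}, G ib.2.1 →* GraphProduct Γ G :=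
      fun ib => (MulAut.conj (O s₁ (g ib.1))⁻¹).toMonoidHom.comp (O ib.2.1)
    have hfl : ∀ a x, fl a x = O a.1 x.1 := fun a x => rfl
    have hfr : ∀ i b x, fr (i, b) x = (O s₁ (g i))⁻¹ * O b.1 x * O s₁ (g i) := by
      intro i b x
      simp [fr, MulAut.conj_apply]
    obtain ⟨F, hF⟩ := GraphProduct.exists_lift (Γ.expand s₁ k) (expandLabel Γ G s₁ H k)
      (K := GraphProduct Γ G) (fun v => match v with
        | Sum.inl a => fl a
        | Sum.inr ib => fr ib) (by
        have key : ∀ (a : {s : S // s ∈ Γ.starSet s₁}) (i : Fin k)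
            (b : {s : S // s ∉ Γ.starSet s₁}), Γ.Adj a.1 b.1 → ∀ x y,
            O a.1 x * ((O s₁ (g i))⁻¹ * O b.1 y * O s₁ (g i)) =
            ((O s₁ (g i))⁻¹ * O b.1 y * O s₁ (g i)) * O a.1 x := by
          intro a i b h x y
          have ha : Γ.Adj s₁ a.1 := by
            rcases hstar a.1 a.2 with e | e
            · rw [e] at h; exact absurd h (notMem_star b.2).2
            · exact e
          have c1 : Commute (O a.1 x) (O s₁ (g i)) := hO ha.symm _ _
          have c2 : Commute (O a.1 x) (O b.1 y) := hO h _ _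
          exact ((c1.inv_right.mul_right c2).mul_right c1).eq
        have key2 : ∀ (a : {s : S // s ∈ Γ.starSet s₁}) (i : Fin k)
            (b : {s : S // s ∉ Γ.starSet s₁}), Γ.Adj a.1 b.1 → ∀ x y,
            fl a x * fr (i, b) y = fr (i, b) y * fl a x := by
          intro a i b h x y
          rw [hfl, hfr]
          exact key a i b h _ _
        rintro (a | ⟨i, b⟩) (c | ⟨j, d⟩) h x y
        · exact hO h _ _
        · exact key2 a j d h x y
        · exact (key2 c i b h y x).symm
        · obtain ⟨rfl, h⟩ := h
          have := congrArg (MulAut.conj (O s₁ (g i))⁻¹) (hO h x y)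
          rw [map_mul, map_mul] at this
          exact this)
    refine ⟨F, fun a x => hF (Sum.inl a) x, fun i b x => (hF (Sum.inr (i, b)) x).trans (hfr i b x)⟩
  -- homs into K
  let eta : H →* K := (Ol ⟨s₁, hs₁⟩).comp
    (H.subtype.codRestrict (Hsub G s₁ H s₁) (fun x => by rw [Hsub_self]; exact x.2))
  let lam : ∀ s, Γ.Adj s₁ s → G s →* K := fun s h => (Ol ⟨s, hlk s h⟩).comp
    ((MonoidHom.id (G s)).codRestrict (Hsub G s₁ H s) (fun x => by
      rw [Hsub_ne G s₁ H h.ne']; trivial))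
  have hφe : ∀ h : H, φ (eta h) = O s₁ h := fun h => hφl _ _
  have hφlam : ∀ s hs x, φ (lam s hs x) = O s x := fun s hs x => hφl _ _
  obtain ⟨A, hA⟩ := exists_cosetHom H g hg eta
  have hρ : ∀ s, ∃ ρ : G s →* Equiv.Perm (Fin k × K),
      (s = s₁ → HEq ρ A) ∧ (∀ h : Γ.Adj s₁ s, ρ = sliceHom (fun _ => lam s h)) ∧
      (∀ h : s ∉ Γ.starSet s₁, ρ = sliceHom (fun i => Or i ⟨s, h⟩)) := by
    intro s
    by_cases h1 : s = s₁
    · subst h1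
      exact ⟨A, fun _ => HEq.rfl, fun h => absurd rfl h.ne, fun h => absurd hs₁ h⟩
    by_cases h2 : Γ.Adj s₁ s
    · exact ⟨sliceHom (fun _ => lam s h2), fun h => absurd h h1, fun _ => rfl,
        fun h => absurd (hlk s h2) h⟩
    · have h3 : s ∉ Γ.starSet s₁ := fun h => (hstar s h).elim h1 h2
      exact ⟨sliceHom (fun i => Or i ⟨s, h3⟩), fun h => absurd h h1, fun h => absurd h h2,
        fun _ => rfl⟩
  choose ρ hρ1 hρ2 hρ3 using hρ
  have hρ1 : ρ s₁ = A := eq_of_heq (hρ1 s₁ rfl)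
  have hcos : ∀ v : G s₁, ∃ (j : Fin k) (h : H), v = g j * h := by
    intro v
    obtain ⟨i, hi⟩ := hg.2 (QuotientGroup.mk v)
    exact ⟨i, ⟨(g i)⁻¹ * v, QuotientGroup.eq.1 hi⟩, by simp⟩
  -- commutation of the permutations
  have hcA : ∀ t, Γ.Adj s₁ t → ∀ x y, ρ s₁ x * ρ t y = ρ t y * ρ s₁ x := by
    intro t ht x y
    rw [hρ1, hρ2 t ht]
    ext1 ⟨i, z⟩
    obtain ⟨j, h, e⟩ := hcos (x * g i)
    rw [Equiv.Perm.mul_apply, Equiv.Perm.mul_apply, sliceHom_apply, hA x i j h _ e,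
      hA x i j h _ e, sliceHom_apply, ← mul_assoc, ← mul_assoc]
    congr 2
    exact hll ⟨s₁, hs₁⟩ ⟨t, hlk t ht⟩ ht _ _
  have hslice : ∀ (M N : Type _) [Group M] [Group N] (f : Fin k → M →* K) (f' : Fin k → N →* K)
      (x : M) (y : N), (∀ i, f i x * f' i y = f' i y * f i x) →
      sliceHom f x * sliceHom f' y = sliceHom f' y * sliceHom f x := by
    intro M N _ _ f f' x y h
    ext1 ⟨i, z⟩
    rw [Equiv.Perm.mul_apply, Equiv.Perm.mul_apply, sliceHom_apply, sliceHom_apply,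
      sliceHom_apply, sliceHom_apply, ← mul_assoc, ← mul_assoc, h]
  have hcase : ∀ s, s = s₁ ∨ Γ.Adj s₁ s ∨ s ∉ Γ.starSet s₁ := by
    intro s
    by_cases h : s ∈ Γ.starSet s₁
    · rcases hstar s h with h | h <;> simp [h]
    · simp [h]
  obtain ⟨α, hα⟩ := GraphProduct.exists_lift Γ G ρ (by
    intro s t hst x y
    rcases hcase s with rfl | hs | hs
    · exact hcA t hst x y
    · rcases hcase t with rfl | ht | ht
      · exact (hcA s hs y x).symm
      · rw [hρ2 s hs, hρ2 t ht]
        exact hslice _ _ _ _ _ _ fun i => hll ⟨s, hlk s hs⟩ ⟨t, hlk t ht⟩ hst _ _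
      · rw [hρ2 s hs, hρ3 t ht]
        exact hslice _ _ _ _ _ _ fun i => hlr ⟨s, hlk s hs⟩ i ⟨t, ht⟩ hst _ _
    · rcases hcase t with rfl | ht | ht
      · exact absurd hst.symm (notMem_star hs).2
      · rw [hρ3 s hs, hρ2 t ht]
        exact hslice _ _ _ _ _ _ fun i => (hlr ⟨t, hlk t ht⟩ i ⟨s, hs⟩ hst.symm _ _).symm
      · rw [hρ3 s hs, hρ3 t ht]
        exact hslice _ _ _ _ _ _ fun i => hrr i ⟨s, hs⟩ ⟨t, ht⟩ hst _ _)
  have hα1 : ∀ (u : G s₁) (i j : Fin k) (h : H) (y : K), u * g i = g j * h →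
      α (O s₁ u) (i, y) = (j, eta h * y) := by
    intro u i j h y e
    rw [hα, hρ1, hA u i j h y e]
  have hα2 : ∀ s (hs : Γ.Adj s₁ s) x i y, α (O s x) (i, y) = (i, lam s hs x * y) := by
    intro s hs x i y
    rw [hα, hρ2 s hs, sliceHom_apply]
  have hα3 : ∀ s (hs : s ∉ Γ.starSet s₁) x i y, α (O s x) (i, y) = (i, Or i ⟨s, hs⟩ x * y) := by
    intro s hs x i y
    rw [hα, hρ3 s hs, sliceHom_apply]
  -- base point
  obtain ⟨i₀, h', e₀⟩ := hcos 1
  obtain ⟨h₀, e₀⟩ : ∃ h₀ : H, g i₀ = h₀ := ⟨h'⁻¹, by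
    rw [Subgroup.coe_inv]; exact eq_inv_of_mul_eq_one_left e₀.symm⟩
  have hgι : ∀ i y, α (O s₁ (g i)) (i₀, eta h₀⁻¹ * y) = (i, y) := by
    intro i y
    rw [hα1 (g i) i₀ i h₀ _ (by rw [e₀]), ← mul_assoc, ← map_mul]
    simp
  have hφι : ∀ z y, α (φ z) (i₀, eta h₀⁻¹ * y) = (i₀, eta h₀⁻¹ * (z * y)) := by
    intro z
    refine hind (fun z => ∀ y, α (φ z) (i₀, eta h₀⁻¹ * y) = (i₀, eta h₀⁻¹ * (z * y)))
      ?_ ?_ ?_ ?_ z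
    · intro y; simp
    · rintro ⟨s, hs⟩ x y
      rcases hstar s hs with rfl | h
      · obtain ⟨x, hx⟩ := x
        have hx' : x ∈ H := by rw [← Hsub_self G s H]; exact hx
        have e1 : Ol ⟨s, hs⟩ ⟨x, hx⟩ = eta ⟨x, hx'⟩ := rfl
        rw [e1, hφe, hα1 x i₀ i₀ (h₀⁻¹ * ⟨x, hx'⟩ * h₀) _ (by rw [e₀]; simp [mul_assoc])]
        simp only [map_mul, map_inv, mul_assoc, mul_inv_cancel_left]
      · have e1 : Ol ⟨s, hs⟩ x = lam s h x.1 := rfl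
        rw [e1, hφlam s h, hα2 s h, ← mul_assoc, ← mul_assoc]
        congr 2
        exact hll ⟨s, hs⟩ ⟨s₁, hs₁⟩ h.symm _ _
    · intro i b x y
      rw [hφr, map_mul, map_mul, Equiv.Perm.mul_apply, Equiv.Perm.mul_apply, hgι, hα3 b.1 b.2,
        map_inv, Equiv.Perm.inv_eq_iff_eq, hgι]
    · intro x z hx hz y
      rw [map_mul, map_mul, Equiv.Perm.mul_apply, hz, hx, mul_assoc]
  have hinj : Function.Injective φ := by
    intro z w e
    have h1 := hφι z 1
    rw [e, hφι w 1] at h1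
    simpa using (Prod.ext_iff.1 h1).2.symm
  -- equivariance
  have hθ : ∀ u p, O s₁ (g (α u p).1) * φ (α u p).2 = u * (O s₁ (g p.1) * φ p.2) := by
    intro u
    refine GraphProduct.induction Γ G (fun u => ∀ p,
      O s₁ (g (α u p).1) * φ (α u p).2 = u * (O s₁ (g p.1) * φ p.2)) ?_ ?_ ?_ u
    · intro p; simp
    · rintro s x ⟨i, y⟩
      change O s₁ (g (α (O s x) (i, y)).1) * φ (α (O s x) (i, y)).2 =
        O s x * (O s₁ (g i) * φ y)
      rcases hcase s with rfl | h | h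
      · obtain ⟨j, h, e⟩ := hcos (x * g i)
        rw [hα1 x i j h y e]
        simp only [map_mul, hφe, ← mul_assoc]
        rw [← map_mul, ← map_mul, e]
      · rw [hα2 s h]
        simp only [map_mul, hφlam, ← mul_assoc]
        rw [hO h]
      · rw [hα3 s h]
        simp only [map_mul, hφr]
        group
    · intro x y hx hy p
      rw [map_mul, Equiv.Perm.mul_apply, hx, hy, mul_assoc]
  refine ⟨φ, hφl, hφr, ?_, hinj, ?_⟩
  · rintro ψ ⟨h1, h2⟩
    ext z
    refine hind (fun z => ψ z = φ z) ?_ ?_ ?_ ?_ z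
    · simp
    · intro a x; exact (h1 a x).trans (hφl a x).symm
    · intro i b x; exact (h2 i b x).trans (hφr i b x).symm
    · intro x y hx hy; rw [map_mul, map_mul, hx, hy]
  · have hb : Function.Bijective
        (fun i : Fin k => (QuotientGroup.mk (O s₁ (g i)) : GraphProduct Γ G ⧸ φ.range)) := by
      constructor
      · intro i j e
        obtain ⟨z, hz⟩ := QuotientGroup.eq.1 e
        have h1 : O s₁ (g j) = O s₁ (g i) * φ z := by rw [hz]; simp
        have h2 := hgι j 1
        rw [h1, map_mul, Equiv.Perm.mul_apply, hφι, hgι] at h2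
        exact (Prod.ext_iff.1 h2).1
      · intro q
        obtain ⟨u, rfl⟩ := QuotientGroup.mk_surjective q
        have h1 := hθ u (i₀, eta h₀⁻¹)
        have h2 : O s₁ (g i₀) * φ (eta h₀⁻¹) = 1 := by
          rw [hφe, e₀, ← map_mul]; simp
        simp only [h2, mul_one] at h1
        refine ⟨(α u (i₀, eta h₀⁻¹)).1, QuotientGroup.eq.2 ⟨(α u (i₀, eta h₀⁻¹)).2, ?_⟩⟩
        exact eq_inv_mul_of_mul_eq h1
    rw [Subgroup.index, ← Nat.card_congr (Equiv.ofBijective _ hb)]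
    simp
end

section
/- Let Γ be a finite simple graph that is not complete (i.e., Γ has two distinct non-adjacent vertices), label every vertex of Γ with the free group F₂ on two generators, and let G_Γ be the corresponding graph product. Then there exist a finite simple graph Γ' and a labeling of its vertices by groups, each isomorphic to F₂ or to the free group F₃ on three generators, such that Γ' is not isomorphic to Γ but the graph product G_{Γ'} is isomorphic to a subgroup of index 2 of G_Γ. Moreover, if Γ is rigid, then Γ' can be chosen to be rigid. -/
namespace GPaux

section general
variable {S : Type*} (Γ : SimpleGraph S) (A : S → Type*)

/-- generator -/
def gen (t : S) (i : A t) : GraphProduct Γ (fun t => FreeGroup (A t)) :=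
  GraphProduct.of Γ (fun t => FreeGroup (A t)) t (FreeGroup.of i)

theorem gen_comm {s t : S} (h : Γ.Adj s t) (i : A s) (j : A t) :
    Commute (gen Γ A s i) (gen Γ A t j) := by
  let X : Monoid.CoprodI (fun t => FreeGroup (A t)) :=
    Monoid.CoprodI.of (i := s) (FreeGroup.of i)
  let Y : Monoid.CoprodI (fun t => FreeGroup (A t)) :=
    Monoid.CoprodI.of (i := t) (FreeGroup.of j)
  have h1 : (QuotientGroup.mk' (Subgroup.normalClosure
      (graphProductRels Γ (fun t => FreeGroup (A t))))) (X * Y * X⁻¹ * Y⁻¹) = 1 := by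
    rw [QuotientGroup.mk'_apply, QuotientGroup.eq_one_iff]
    exact Subgroup.subset_normalClosure ⟨s, t, _, _, h, rfl⟩
  simp only [map_mul, map_inv] at h1
  rw [mul_inv_eq_one, mul_inv_eq_iff_eq_mul] at h1
  exact h1

theorem gen_top (K : Subgroup (GraphProduct Γ (fun t => FreeGroup (A t))))
    (h : ∀ t i, gen Γ A t i ∈ K) (x) : x ∈ K := by
  obtain ⟨y, rfl⟩ := QuotientGroup.mk'_surjective _ x
  induction y using Monoid.CoprodI.induction_on with
  | one => rw [map_one]; exact K.one_mem
  | of t m =>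
    change GraphProduct.of Γ (fun t => FreeGroup (A t)) t m ∈ K
    induction m using FreeGroup.induction_on with
    | C1 => rw [map_one]; exact K.one_mem
    | of i => exact h t i
    | inv_of i hi => rw [map_inv]; exact K.inv_mem hi
    | mul a b ha hb => rw [map_mul]; exact K.mul_mem ha hb
  | mul a b ha hb => rw [map_mul]; exact K.mul_mem ha hb

variable {Γ A}

theorem lift_commute {M : Type*} [Group M] {X Y : Type*} (f : X → M) (g : Y → M)
    (h : ∀ i j, Commute (f i) (g j)) (x : FreeGroup X) (y : FreeGroup Y) :
    Commute (FreeGroup.lift f x) (FreeGroup.lift g y) := by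
  induction x using FreeGroup.induction_on with
  | C1 => rw [map_one]; exact Commute.one_left _
  | inv_of i hi => rw [map_inv]; exact hi.inv_left
  | mul a b ha hb => rw [map_mul]; exact ha.mul_left hb
  | of i =>
    induction y using FreeGroup.induction_on with
    | C1 => rw [map_one]; exact Commute.one_right _
    | inv_of i hi => rw [map_inv]; exact hi.inv_right
    | mul a b ha hb => rw [map_mul]; exact ha.mul_right hb
    | of j => simpa using h i j

/-- universal property -/
def glift {M : Type*} [Group M] (f : ∀ t, A t → M)
    (hc : ∀ s t, Γ.Adj s t → ∀ i j, Commute (f s i) (f t j)) :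
    GraphProduct Γ (fun t => FreeGroup (A t)) →* M :=
  QuotientGroup.lift _ (Monoid.CoprodI.lift (fun t => FreeGroup.lift (f t))) (by
    intro x hx
    refine (Subgroup.normalClosure_le_normal ?_) hx
    rintro _ ⟨s, t, g, h, hst, rfl⟩
    have := lift_commute (f s) (f t) (hc s t hst) g h
    simp only [SetLike.mem_coe, MonoidHom.mem_ker, map_mul, map_inv, Monoid.CoprodI.lift_of]
    rw [mul_inv_eq_one, mul_inv_eq_iff_eq_mul]
    exact this)

theorem glift_gen {M : Type*} [Group M] (f : ∀ t, A t → M)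
    (hc : ∀ s t, Γ.Adj s t → ∀ i j, Commute (f s i) (f t j)) (t : S) (i : A t) :
    glift f hc (gen Γ A t i) = f t i := by
  change (Monoid.CoprodI.lift (fun t => FreeGroup.lift (f t)))
    (Monoid.CoprodI.of (FreeGroup.of i)) = _
  rw [Monoid.CoprodI.lift_of, FreeGroup.lift_apply_of]

end general

section perm
variable {H : Type*} [Group H]

/-- diagonal permutation -/
def dg (α β : H) : Equiv.Perm (H × Bool) where
  toFun x := ((if x.2 then β else α) * x.1, x.2)
  invFun x := ((if x.2 then β else α)⁻¹ * x.1, x.2)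
  left_inv := by rintro ⟨x, _ | _⟩ <;> simp
  right_inv := by rintro ⟨x, _ | _⟩ <;> simp

/-- twisted swap -/
def sw (α : H) : Equiv.Perm (H × Bool) where
  toFun x := ((if x.2 then α * x.1 else x.1), !x.2)
  invFun x := ((if x.2 then x.1 else α⁻¹ * x.1), !x.2)
  left_inv := by rintro ⟨x, _ | _⟩ <;> simp
  right_inv := by rintro ⟨x, _ | _⟩ <;> simp

theorem dg_comm {α β γ δ : H} (h : Commute α γ) (h' : Commute β δ) :
    Commute (dg α β) (dg γ δ) := by
  ext ⟨x, _ | _⟩ : 1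
  · simp [dg, ← mul_assoc, h.eq]
  · simp [dg, ← mul_assoc, h'.eq]

theorem sw_comm {α β : H} (h : Commute α β) :
    Commute (sw α) (dg β β) := by
  ext ⟨x, _ | _⟩ : 1
  · simp [dg, sw]
  · simp [dg, sw, ← mul_assoc, h.eq]

end perm

section dbl
variable {S : Type*} (Γ : SimpleGraph S) (s : S) {n : ℕ} (e : S ≃ Fin n)

/-- star of the vertex -/
def St (t : S) : Prop := t = s ∨ Γ.Adj s t

/-- vertices of the doubled graph -/
abbrev T : Type := {x : Fin n × Bool // x.2 = true → ¬ St Γ s (e.symm x.1)}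

/-- projection -/
def p (x : T Γ s e) : S := e.symm x.1.1
/-- copy -/
def bit (x : T Γ s e) : Bool := x.1.2

variable {Γ s e}
theorem bit_star {x : T Γ s e} (h : St Γ s (p Γ s e x)) : bit Γ s e x = false := by
  by_contra h'
  exact x.2 (by simpa [bit] using h') h

theorem T_ext {x y : T Γ s e} (h : p Γ s e x = p Γ s e y) (h' : bit Γ s e x = bit Γ s e y) :
    x = y := by
  apply Subtype.ext
  exact Prod.ext (e.symm.injective h) h'
variable (Γ s e)

open Classical in
/-- vertex from data -/
noncomputable def v (t : S) (b : Bool) : T Γ s e :=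
  ⟨(e t, b && !decide (St Γ s t)), by simp⟩

@[simp] theorem p_v (t : S) (b : Bool) : p Γ s e (v Γ s e t b) = t := by simp [p, v]
open Classical in
theorem bit_v (t : S) (b : Bool) : bit Γ s e (v Γ s e t b) = (b && !decide (St Γ s t)) := rfl

theorem v_eq (x : T Γ s e) : v Γ s e (p Γ s e x) (bit Γ s e x) = x := by
  apply T_ext
  · simp
  · rw [bit_v]
    by_cases h : St Γ s (p Γ s e x)
    · simp [h, bit_star h]
    · simp [h]

theorem v_star {t : S} (h : St Γ s t) (b : Bool) : v Γ s e t b = v Γ s e t false := by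
  apply T_ext
  · simp
  · simp [bit_v, h]

/-- doubled graph -/
def dbl : SimpleGraph (T Γ s e) where
  Adj x y := Γ.Adj (p Γ s e x) (p Γ s e y) ∧
    (bit Γ s e x = bit Γ s e y ∨ St Γ s (p Γ s e x) ∨ St Γ s (p Γ s e y))
  symm := ⟨by
    rintro x y ⟨h, h'⟩
    exact ⟨h.symm, by tauto⟩⟩
  loopless := ⟨by rintro x ⟨h, -⟩; exact h.ne rfl⟩

theorem dbl_rigid (h : Γ.Rigid) : (dbl Γ s e).Rigid := by
  intro x
  apply Set.eq_singleton_iff_unique_mem.2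
  refine ⟨fun y hy => (SimpleGraph.mem_neighborSet _ _ _ |>.1 hy).symm, ?_⟩
  intro w hw
  have hpw : p Γ s e w = p Γ s e x := by
    have : p Γ s e w ∈ Γ.linkOfSet (Γ.neighborSet (p Γ s e x)) := by
      intro t ht
      have := hw (v Γ s e t (bit Γ s e x)) ⟨by simpa using ht, by
        by_cases h : St Γ s t
        · simp [h]
        · simp [bit_v, h]⟩
      simpa using this.1
    rw [h] at this
    exact this
  refine T_ext hpw ?_
  by_cases hs : St Γ s (p Γ s e x)
  · rw [bit_star hs, bit_star (hpw ▸ hs)]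
  · by_contra hb
    have : s ∈ Γ.linkOfSet (Γ.neighborSet (p Γ s e x)) := by
      intro t ht
      by_contra hst
      have hts : ¬ St Γ s t := by
        rintro (rfl | h')
        · exact hs (Or.inr ht.symm)
        · exact hst h'.symm
      have := hw (v Γ s e t (bit Γ s e x)) ⟨by simpa using ht, by simp [bit_v, hts]⟩
      have := this.2
      simp only [p_v, hts, hpw, hs, or_false, bit_v] at this
      simp at this
      exact hb this.symm
    rw [h] at this
    exact hs (Or.inl this.symm)

theorem dbl_noniso (hs : ∃ t, s ≠ t ∧ ¬ Γ.Adj s t) : IsEmpty (Γ ≃g dbl Γ s e) := by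
  constructor
  intro f
  obtain ⟨t, hst, ht⟩ := hs
  have hts : ¬ St Γ s t := by rintro (h | h); exacts [hst h.symm, ht h]
  have : Finite S := Finite.of_equiv _ e.symm
  have hsurj : Function.Surjective (fun x => p Γ s e (f x)) := fun t => by
    obtain ⟨x, hx⟩ := f.surjective (v Γ s e t false)
    exact ⟨x, by simp only; rw [hx]; simp⟩
  have hinj := Finite.injective_iff_surjective.2 hsurj
  obtain ⟨x, hx⟩ := f.surjective (v Γ s e t false)
  obtain ⟨y, hy⟩ := f.surjective (v Γ s e t true)
  have hxy : x = y := hinj (by simp only; rw [hx, hy]; simp)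
  subst hxy
  have := congrArg (bit Γ s e) (hx.symm.trans hy)
  simp [bit_v, hts] at this

/-- labels -/
abbrev L (x : T Γ s e) : Type := {k : Fin 3 // k = 2 → p Γ s e x = s}

/-- the big group -/
abbrev G : Type _ := GraphProduct Γ (fun _ => FreeGroup (Fin 2))
/-- the small group -/
abbrev H : Type _ := GraphProduct (dbl Γ s e) (fun x => FreeGroup (L Γ s e x))

/-- generators of the big group -/
abbrev g (t : S) (i : Fin 2) : G Γ := gen Γ (fun _ => Fin 2) t i

open Classical in
/-- generators of the small group -/
noncomputable def w (x : T Γ s e) (k : Fin 3) : H Γ s e :=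
  if h : k = 2 → p Γ s e x = s then gen (dbl Γ s e) (L Γ s e) x ⟨k, h⟩ else 1

theorem w_eq (x : T Γ s e) (k : L Γ s e x) :
    gen (dbl Γ s e) (L Γ s e) x k = w Γ s e x k.1 := by
  rw [w, dif_pos k.2]

theorem w_comm {x y : T Γ s e} (h : (dbl Γ s e).Adj x y) (i j : Fin 3) :
    Commute (w Γ s e x i) (w Γ s e y j) := by
  unfold w
  split_ifs
  · exact gen_comm _ _ h _ _
  · exact Commute.one_right _
  · exact Commute.one_left _
  · exact Commute.one_left _

/-- index collapse -/
def κ (k : Fin 3) : Fin 2 := if k = 0 then 0 else 1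

open Classical in
/-- images of generators -/
noncomputable def f (x : T Γ s e) (k : Fin 3) : G Γ :=
  if p Γ s e x = s then
    (if k = 0 then g Γ s 0 * g Γ s 0 else if k = 1 then g Γ s 1 else
      (g Γ s 0)⁻¹ * g Γ s 1 * g Γ s 0)
  else if bit Γ s e x then (g Γ s 0)⁻¹ * g Γ (p Γ s e x) (κ k) * g Γ s 0
  else g Γ (p Γ s e x) (κ k)

theorem f_comm_link {x y : T Γ s e} (h : Γ.Adj (p Γ s e x) (p Γ s e y))
    (hs : Γ.Adj s (p Γ s e y)) (i j : Fin 3) : Commute (f Γ s e x i) (f Γ s e y j) := by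
  have hy : f Γ s e y j = g Γ (p Γ s e y) (κ j) := by
    rw [f, if_neg hs.ne', bit_star (Or.inr hs)]; simp
  rw [hy]
  have c : ∀ k, Commute (g Γ s k) (g Γ (p Γ s e y) (κ j)) := fun k => gen_comm _ _ hs _ _
  have c' : ∀ k, Commute (g Γ (p Γ s e x) k) (g Γ (p Γ s e y) (κ j)) :=
    fun k => gen_comm _ _ h _ _
  unfold f
  split_ifs
  · exact (c 0).mul_left (c 0)
  · exact c 1
  · exact ((c 0).inv_left.mul_left (c 1)).mul_left (c 0)
  · exact ((c 0).inv_left.mul_left (c' _)).mul_left (c 0)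
  · exact c' _

theorem f_comm {x y : T Γ s e} (h : (dbl Γ s e).Adj x y) (i j : Fin 3) :
    Commute (f Γ s e x i) (f Γ s e y j) := by
  by_cases hy : Γ.Adj s (p Γ s e y)
  · exact f_comm_link Γ s e h.1 hy i j
  by_cases hx : Γ.Adj s (p Γ s e x)
  · exact (f_comm_link Γ s e h.1.symm hx j i).symm
  have hxs : p Γ s e x ≠ s := fun h' => hy (by have := h.1; rwa [h'] at this)
  have hys : p Γ s e y ≠ s := fun h' => hx (by have := h.1.symm; rwa [h'] at this)
  have hb : bit Γ s e x = bit Γ s e y := by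
    rcases h.2 with h | h | h
    · exact h
    · exact absurd h (by rintro (h | h); exacts [hxs h, hx h])
    · exact absurd h (by rintro (h | h); exacts [hys h, hy h])
  have c : Commute (g Γ (p Γ s e x) (κ i)) (g Γ (p Γ s e y) (κ j)) := gen_comm _ _ h.1 _ _
  rw [f, f, if_neg hxs, if_neg hys, hb]
  split_ifs
  · have := c.eq
    change _ * _ = _ * _
    calc _ = (g Γ s 0)⁻¹ * (g Γ (p Γ s e x) (κ i) * g Γ (p Γ s e y) (κ j)) * g Γ s 0 := by group
      _ = _ := by rw [this]; group
  · exact c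

/-- the embedding -/
noncomputable def φ : H Γ s e →* G Γ :=
  glift (fun x k => f Γ s e x k.1) (fun _ _ h i j => f_comm Γ s e h i.1 j.1)

theorem φ_w (x : T Γ s e) (k : Fin 3) (h : k = 2 → p Γ s e x = s) :
    φ Γ s e (w Γ s e x k) = f Γ s e x k := by
  rw [w, dif_pos h]
  exact glift_gen (A := L Γ s e) _ _ x ⟨k, h⟩

/-- inclusion of indices -/
def ι (i : Fin 2) : Fin 3 := Fin.castSucc i

theorem ι_ne : ∀ i, ι i ≠ 2 := by decide
theorem κι : ∀ i, κ (ι i) = i := by decide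

open Classical in
/-- permutation action of generators -/
noncomputable def q (t : S) (i : Fin 2) : Equiv.Perm (H Γ s e × Bool) :=
  if t = s then (if i = 0 then sw (w Γ s e (v Γ s e s false) 0)
    else dg (w Γ s e (v Γ s e s false) 1) (w Γ s e (v Γ s e s false) 2))
  else dg (w Γ s e (v Γ s e t false) (ι i)) (w Γ s e (v Γ s e t true) (ι i))

theorem q_comm_s {t : S} (h : Γ.Adj s t) (i j : Fin 2) :
    Commute (q Γ s e s i) (q Γ s e t j) := by
  have c : ∀ k l, Commute (w Γ s e (v Γ s e s false) k) (w Γ s e (v Γ s e t false) l) :=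
    fun k l => w_comm Γ s e ⟨by simpa using h, by simp [St]⟩ k l
  rw [q, q, if_pos rfl, if_neg h.ne', v_star Γ s e (Or.inr h) true]
  split_ifs
  · exact sw_comm (c _ _)
  · exact dg_comm (c _ _) (c _ _)

theorem q_comm {t t' : S} (h : Γ.Adj t t') (i j : Fin 2) :
    Commute (q Γ s e t i) (q Γ s e t' j) := by
  by_cases ht : t = s
  · subst ht; exact q_comm_s Γ _ e h i j
  by_cases ht' : t' = s
  · subst ht'; exact (q_comm_s Γ _ e h.symm j i).symm
  rw [q, q, if_neg ht, if_neg ht']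
  have c : ∀ b k l, Commute (w Γ s e (v Γ s e t b) k) (w Γ s e (v Γ s e t' b) l) :=
    fun b k l => w_comm Γ s e ⟨by simpa using h, by
      by_cases h1 : St Γ s t
      · simp [h1]
      by_cases h2 : St Γ s t'
      · simp [h2]
      simp [bit_v, h1, h2]⟩ k l
  exact dg_comm (c _ _ _) (c _ _ _)

/-- the action -/
noncomputable def ψ : G Γ →* Equiv.Perm (H Γ s e × Bool) :=
  glift (A := fun _ => Fin 2) (fun t i => q Γ s e t i) (fun _ _ h i j => q_comm Γ s e h i j)

theorem ψ_g (t : S) (i : Fin 2) : ψ Γ s e (g Γ t i) = q Γ s e t i :=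
  glift_gen (A := fun _ => Fin 2) _ _ t i

theorem ψ_f (x : T Γ s e) (k : Fin 3) (hk : k = 2 → p Γ s e x = s) (h : H Γ s e) :
    ψ Γ s e (f Γ s e x k) (h, false) = (w Γ s e x k * h, false) := by
  have ha : q Γ s e s 0 = sw (w Γ s e (v Γ s e s false) 0) := by simp [q]
  have hb : q Γ s e s 1 = dg (w Γ s e (v Γ s e s false) 1) (w Γ s e (v Γ s e s false) 2) := by
    simp [q]
  have hinv : ∀ y, Equiv.symm (sw (w Γ s e (v Γ s e s false) 0)) (y, true) = (y, false) := fun y => by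
    rw [Equiv.symm_apply_eq]; simp [sw]
  by_cases hx : p Γ s e x = s
  · have hxv : v Γ s e s false = x := by
      have := v_eq Γ s e x
      rwa [bit_star (Or.inl hx), hx] at this
    rw [f, if_pos hx]
    rw [hxv] at ha hb hinv
    fin_cases k
    · simp [ψ_g, ha, sw]
    · simp [ψ_g, hb, dg]
    · have : ∀ y, sw (w Γ s e x 0) (y, false) = (y, true) := fun y => by simp [sw]
      simp [ψ_g, ha, hb, this, dg, hinv]
  · have hk2 : ι (κ k) = k := by
      have : k ≠ 2 := fun h => hx (hk h)
      clear hk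
      revert this
      revert k; decide
    have hv := v_eq Γ s e x
    have hq : q Γ s e (p Γ s e x) (κ k) = dg (w Γ s e (v Γ s e (p Γ s e x) false) k)
        (w Γ s e (v Γ s e (p Γ s e x) true) k) := by
      rw [q, if_neg hx, hk2]
    rw [f, if_neg hx]
    cases hbit : bit Γ s e x with
    | false =>
      rw [hbit] at hv
      rw [hv] at hq
      simp [ψ_g, hq, dg]
    | true =>
      rw [hbit] at hv
      rw [hv] at hq
      have : ∀ y, sw (w Γ s e (v Γ s e s false) 0) (y, false) = (y, true) := fun y => by simp [sw]
      simp [ψ_g, hq, dg, ha, this, hinv]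

theorem ψφ (x : H Γ s e) (h : H Γ s e) :
    ψ Γ s e (φ Γ s e x) (h, false) = (x * h, false) := by
  let K : Subgroup (H Γ s e) :=
    { carrier := {x | ∀ h, ψ Γ s e (φ Γ s e x) (h, false) = (x * h, false)}
      one_mem' := by intro h; simp
      mul_mem' := by
        intro a b ha hb h
        rw [map_mul, map_mul, Equiv.Perm.mul_apply, hb, ha, mul_assoc]
      inv_mem' := by
        intro a ha h
        rw [map_inv, map_inv, Equiv.Perm.inv_eq_iff_eq, ha, mul_inv_cancel_left] }
  refine gen_top _ _ K ?_ x h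
  intro t i h
  rw [w_eq, φ_w Γ s e t i.1 i.2, ψ_f Γ s e t i.1 i.2]

theorem φ_inj : Function.Injective (φ Γ s e) := by
  intro x y hxy
  have h1 := ψφ Γ s e x 1
  rw [hxy, ψφ] at h1
  simpa using h1.symm

theorem f_mem (x : T Γ s e) (k : Fin 3) (h : k = 2 → p Γ s e x = s) :
    f Γ s e x k ∈ (φ Γ s e).range := ⟨_, φ_w Γ s e x k h⟩

theorem aa_mem : g Γ s 0 * g Γ s 0 ∈ (φ Γ s e).range := by
  simpa [f] using f_mem Γ s e (v Γ s e s false) 0 (by simp)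

theorem b_mem : g Γ s 1 ∈ (φ Γ s e).range := by
  simpa [f] using f_mem Γ s e (v Γ s e s false) 1 (by simp)

theorem bc_mem : (g Γ s 0)⁻¹ * g Γ s 1 * g Γ s 0 ∈ (φ Γ s e).range := by
  simpa [f] using f_mem Γ s e (v Γ s e s false) 2 (by simp)

theorem t_mem {t : S} (ht : t ≠ s) (i : Fin 2) : g Γ t i ∈ (φ Γ s e).range := by
  have := f_mem Γ s e (v Γ s e t false) (ι i) (fun h => absurd h (ι_ne i))
  have hk : κ (ι i) = i := κι i
  simpa [f, ht, bit_v, hk] using this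

theorem tc_mem {t : S} (ht : t ≠ s) (i : Fin 2) :
    (g Γ s 0)⁻¹ * g Γ t i * g Γ s 0 ∈ (φ Γ s e).range := by
  by_cases h : Γ.Adj s t
  · have : Commute (g Γ s 0) (g Γ t i) := gen_comm _ _ h _ _
    rw [mul_assoc, ← this.eq, inv_mul_cancel_left]
    exact t_mem Γ s e ht i
  have := f_mem Γ s e (v Γ s e t true) (ι i) (fun h => absurd h (ι_ne i))
  have hk : κ (ι i) = i := κι i
  simpa [f, ht, bit_v, hk, St, h] using this

theorem conj_mem (r : G Γ) (hr : r ∈ (φ Γ s e).range) :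
    g Γ s 0 * r * (g Γ s 0)⁻¹ ∈ (φ Γ s e).range := by
  obtain ⟨x, rfl⟩ := hr
  have key : ∀ r, r ∈ (φ Γ s e).range → (g Γ s 0)⁻¹ * r * g Γ s 0 ∈ (φ Γ s e).range →
      g Γ s 0 * r * (g Γ s 0)⁻¹ ∈ (φ Γ s e).range := by
    intro r _ h
    have := mul_mem (mul_mem (aa_mem Γ s e) h) (inv_mem (aa_mem Γ s e))
    convert this using 1
    group
  have key2 : ∀ r, r ∈ (φ Γ s e).range →
      g Γ s 0 * ((g Γ s 0)⁻¹ * r * g Γ s 0) * (g Γ s 0)⁻¹ ∈ (φ Γ s e).range := by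
    intro r h
    convert h using 1
    group
  refine gen_top _ _ (((φ Γ s e).range.comap (MulAut.conj (g Γ s 0)).toMonoidHom).comap
    (φ Γ s e)) ?_ x
  intro t i
  simp only [Subgroup.mem_comap, MulEquiv.toMonoidHom_eq_coe, MonoidHom.coe_coe,
    MulAut.conj_apply]
  rw [w_eq, φ_w Γ s e t i.1 i.2]
  unfold f
  split_ifs with h1 h2 h3 h4
  · convert aa_mem Γ s e using 1
    group
  · exact key _ (b_mem Γ s e) (bc_mem Γ s e)
  · exact key2 _ (b_mem Γ s e)
  · exact key2 _ (t_mem Γ s e h1 _)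
  · exact key _ (t_mem Γ s e h1 _) (tc_mem Γ s e h1 _)

theorem range_or (b : G Γ) :
    b ∈ (φ Γ s e).range ∨ b * g Γ s 0 ∈ (φ Γ s e).range := by
  have ha := aa_mem Γ s e
  have hc := conj_mem Γ s e
  set R := (φ Γ s e).range
  set a := g Γ s 0
  let K : Subgroup (G Γ) :=
    { carrier := {b | b ∈ R ∨ b * a ∈ R}
      one_mem' := Or.inl R.one_mem
      mul_mem' := by
        rintro x y (hx | hx) (hy | hy)
        · exact Or.inl (mul_mem hx hy)
        · exact Or.inr (by rw [mul_assoc]; exact mul_mem hx hy)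
        · refine Or.inr ?_
          have := mul_mem (mul_mem hx (inv_mem ha)) (mul_mem (hc y hy) ha)
          convert this using 1
          group
        · refine Or.inl ?_
          have := mul_mem (mul_mem hx (inv_mem ha)) (hc _ hy)
          convert this using 1
          group
      inv_mem' := by
        rintro x (hx | hx)
        · exact Or.inl (inv_mem hx)
        · refine Or.inr ?_
          have := mul_mem (hc _ (inv_mem hx)) ha
          convert this using 1
          group }
  refine gen_top Γ (fun _ => Fin 2) K ?_ b
  intro t i
  by_cases ht : t = s
  · subst ht
    fin_cases i
    · exact Or.inr ha
    · exact Or.inl (b_mem Γ _ e)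
  · exact Or.inl (t_mem Γ s e ht i)

theorem a_not_mem : g Γ s 0 ∉ (φ Γ s e).range := by
  rintro ⟨x, hx⟩
  have := ψφ Γ s e x 1
  rw [hx, ψ_g] at this
  simp [q, sw] at this

theorem range_index : (φ Γ s e).range.index = 2 := by
  rw [Subgroup.index_eq_two_iff]
  refine ⟨g Γ s 0, fun b => ?_⟩
  rcases range_or Γ s e b with h | h
  · exact Or.inr ⟨h, fun h' => a_not_mem Γ s e ((Subgroup.mul_mem_cancel_left _ h).1 h')⟩
  · exact Or.inl ⟨h, fun h' => a_not_mem Γ s e ((Subgroup.mul_mem_cancel_left _ h').1 h)⟩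

end dbl
end GPaux

/-- Let `Γ` be a finite simple graph that is not complete, label every vertex with the
free group `F₂` and let `G_Γ` be the graph product.  Then there exist a finite simple
graph `Γ'` and a labeling of its vertices by groups, each isomorphic to `F₂` or `F₃`,
such that `Γ'` is not isomorphic to `Γ`, but the graph product `G_{Γ'}` is isomorphic to a
subgroup of index `2` of `G_Γ`; moreover, if `Γ` is rigid, then `Γ'` can be chosen rigid. -/
theorem graphProduct_free_group_index_two {S : Type*} (Γ : SimpleGraph S) [Fintype S]
    (hnc : ∃ s t : S, s ≠ t ∧ ¬ Γ.Adj s t) :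
    ∃ (T : Type) (_ : Fintype T) (Γ' : SimpleGraph T) (lbl : T → Type)
      (inst : ∀ t, Group (lbl t)),
      (∀ t : T, Nonempty (lbl t ≃* FreeGroup (Fin 2)) ∨
        Nonempty (lbl t ≃* FreeGroup (Fin 3))) ∧
      IsEmpty (Γ ≃g Γ') ∧
      (∃ K : Subgroup (GraphProduct Γ (fun _ => FreeGroup (Fin 2))),
        K.index = 2 ∧ Nonempty ((@GraphProduct T Γ' lbl inst) ≃* ↥K)) ∧
      (Γ.Rigid → Γ'.Rigid) := by
  classical
  obtain ⟨s, t, hst, hadj⟩ := hnc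
  let e := Fintype.equivFin S
  refine ⟨GPaux.T Γ s e, inferInstance, GPaux.dbl Γ s e,
    fun x => FreeGroup (GPaux.L Γ s e x), fun x => inferInstance, ?_,
    GPaux.dbl_noniso Γ s e ⟨t, hst, hadj⟩,
    ⟨(GPaux.φ Γ s e).range, GPaux.range_index Γ s e,
      ⟨MonoidHom.ofInjective (GPaux.φ_inj Γ s e)⟩⟩, GPaux.dbl_rigid Γ s e⟩
  intro x
  by_cases h : GPaux.p Γ s e x = s
  · right
    exact ⟨FreeGroup.freeGroupCongr (Equiv.subtypeUnivEquiv (fun _ _ => h))⟩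
  · left
    refine ⟨FreeGroup.freeGroupCongr (Fintype.equivOfCardEq ?_)⟩
    simp only [GPaux.L, h, imp_false]
    rfl
end

section
/- Let Γ be a simple graph with vertex set S, let (G_s)_{s∈S} be a family of groups and let G_Γ be their graph product. For every subset T ⊆ S, the canonical homomorphism from the graph product of the family (G_s)_{s∈T} over the induced subgraph Γ|_T to G_Γ, induced by the canonical maps G_s → G_Γ for s ∈ T, is injective; its image is the subgroup of G_Γ generated by the images of the G_s with s ∈ T. -/
namespace GraphProduct

/-- The universal property of the graph product. -/
def liftHom {S : Type*} (Γ : SimpleGraph S) (G : S → Type*) [∀ s, Group (G s)]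
    {H : Type*} [Group H] (φ : ∀ s, G s →* H)
    (hφ : ∀ s t, Γ.Adj s t → ∀ (g : G s) (h : G t), Commute (φ s g) (φ t h)) :
    GraphProduct Γ G →* H :=
  QuotientGroup.lift (Subgroup.normalClosure (graphProductRels Γ G))
    (Monoid.CoprodI.lift φ) (by
      have : Subgroup.normalClosure (graphProductRels Γ G) ≤ (Monoid.CoprodI.lift φ).ker := by
        apply Subgroup.normalClosure_le_normal
        rintro x ⟨s, t, g, h, hst, rfl⟩
        have := (hφ s t hst g h).eq
        simp [MonoidHom.mem_ker, this]
      exact this)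

theorem liftHom_of {S : Type*} (Γ : SimpleGraph S) (G : S → Type*) [∀ s, Group (G s)]
    {H : Type*} [Group H] (φ : ∀ s, G s →* H)
    (hφ : ∀ s t, Γ.Adj s t → ∀ (g : G s) (h : G t), Commute (φ s g) (φ t h))
    (s : S) (x : G s) : liftHom Γ G φ hφ (of Γ G s x) = φ s x :=
  (QuotientGroup.lift_mk' _ _ _).trans (Monoid.CoprodI.lift_of φ x)

theorem of_commute {S : Type*} (Γ : SimpleGraph S) (G : S → Type*) [∀ s, Group (G s)]
    (s t : S) (hst : Γ.Adj s t) (g : G s) (h : G t) :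
    Commute (of Γ G s g) (of Γ G t h) := by
  have h1 : Monoid.CoprodI.of g * Monoid.CoprodI.of h *
      (Monoid.CoprodI.of g)⁻¹ * (Monoid.CoprodI.of h)⁻¹ ∈
      Subgroup.normalClosure (graphProductRels Γ G) :=
    Subgroup.subset_normalClosure ⟨s, t, g, h, hst, rfl⟩
  have h2 : of Γ G s g * of Γ G t h * (of Γ G s g)⁻¹ * (of Γ G t h)⁻¹ = 1 :=
    (QuotientGroup.eq_one_iff _).2 h1
  have h3 := mul_inv_eq_one.1 h2
  exact mul_inv_eq_iff_eq_mul.1 h3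

theorem closure_of {S : Type*} (Γ : SimpleGraph S) (G : S → Type*) [∀ s, Group (G s)]
    (K : Subgroup (GraphProduct Γ G)) (hK : ∀ s x, of Γ G s x ∈ K) (y : GraphProduct Γ G) :
    y ∈ K := by
  obtain ⟨z, rfl⟩ := QuotientGroup.mk'_surjective
    (Subgroup.normalClosure (graphProductRels Γ G)) y
  induction z using Monoid.CoprodI.induction_on with
  | one => exact K.one_mem
  | of i m => exact hK i m
  | mul x y hx hy => exact K.mul_mem hx hy

end GraphProduct

/-- For every subset `T` of the vertex set, the canonical homomorphism from the graph
product of `(G s)_{s ∈ T}` over the induced subgraph `Γ|_T` to the graph product `G_Γ`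
(sending the canonical copy of `G s`, `s ∈ T`, identically to its copy in `G_Γ`) is
injective, and its image is the subgroup generated by the images of the `G s`, `s ∈ T`. -/
theorem graphProduct_induce_injective {S : Type*} (Γ : SimpleGraph S) (G : S → Type*)
    [∀ s, Group (G s)] (T : Set S) :
    ∃ f : GraphProduct (Γ.induce T) (fun t => G t.1) →* GraphProduct Γ G,
      (∀ (t : T) (x : G t.1),
        f (GraphProduct.of (Γ.induce T) (fun t => G t.1) t x) = GraphProduct.of Γ G t.1 x) ∧
      Function.Injective f ∧
      MonoidHom.range f =
        Subgroup.closure (⋃ s ∈ T, Set.range (GraphProduct.of Γ G s)) := by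
  classical
  let f : GraphProduct (Γ.induce T) (fun t => G t.1) →* GraphProduct Γ G :=
    GraphProduct.liftHom (Γ.induce T) (fun t => G t.1) (fun t => GraphProduct.of Γ G t.1)
      (fun s t hst g h => GraphProduct.of_commute Γ G s.1 t.1 hst g h)
  have hf : ∀ (t : T) (x : G t.1),
      f (GraphProduct.of (Γ.induce T) (fun t => G t.1) t x) = GraphProduct.of Γ G t.1 x :=
    fun t x => GraphProduct.liftHom_of (Γ.induce T) (fun t => G t.1) _ _ t x
  let φ : ∀ s, G s →* GraphProduct (Γ.induce T) (fun t => G t.1) := fun s =>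
    if hs : s ∈ T then GraphProduct.of (Γ.induce T) (fun t => G t.1) ⟨s, hs⟩ else 1
  have hφ : ∀ s t, Γ.Adj s t → ∀ (g : G s) (h : G t), Commute (φ s g) (φ t h) := by
    intro s t hst g h
    by_cases hs : s ∈ T
    · by_cases ht : t ∈ T
      · simp only [φ, dif_pos hs, dif_pos ht]
        exact GraphProduct.of_commute (Γ.induce T) (fun t => G t.1) ⟨s, hs⟩ ⟨t, ht⟩ hst g h
      · simp only [φ, dif_neg ht]
        exact Commute.one_right _
    · simp only [φ, dif_neg hs]
      exact Commute.one_left _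
  let r := GraphProduct.liftHom Γ G φ hφ
  have hr : ∀ y, r (f y) = y := by
    intro y
    refine GraphProduct.closure_of (Γ.induce T) (fun t => G t.1)
      ((r.comp f).eqLocus (MonoidHom.id _)) (fun t x => ?_) y
    show r (f (GraphProduct.of (Γ.induce T) (fun t => G t.1) t x)) =
      GraphProduct.of (Γ.induce T) (fun t => G t.1) t x
    rw [hf]
    refine (GraphProduct.liftHom_of Γ G φ hφ _ _).trans ?_
    simp only [φ, dif_pos t.2]
  refine ⟨f, hf, Function.LeftInverse.injective hr, le_antisymm ?_ ?_⟩
  · rintro _ ⟨y, rfl⟩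
    refine GraphProduct.closure_of (Γ.induce T) (fun t => G t.1)
      ((Subgroup.closure (⋃ s ∈ T, Set.range (GraphProduct.of Γ G s))).comap f)
      (fun t x => ?_) y
    rw [Subgroup.mem_comap, hf]
    exact Subgroup.subset_closure (Set.mem_biUnion t.2 ⟨x, rfl⟩)
  · rw [Subgroup.closure_le]
    refine Set.iUnion₂_subset fun s hs => ?_
    rintro _ ⟨x, rfl⟩
    exact ⟨_, hf ⟨s, hs⟩ x⟩
end
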